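/- arXiv:1909.00364 — 8 statements merged into one kernel-verified Lean document; each statement's English description precedes it below -/
import Mathlib

section
/- For all nonnegative integers i, j, k, l, the following identity of formal power series in q holds: ∑ q^{T_τ + T_{AB} + T_{AC} + T_{AD} + T_{BC} + T_{BD} + T_{CD} − BC − BD − CD + 4T_{Q−1} + 3Q + 2Qτ} / ((q)_A (q)_B (q)_C (q)_D (q)_{AB} (q)_{AC} (q)_{AD} (q)_{BC} (q)_{BD} (q)_{CD} (q)_Q) · [ (1 − q^A) + q^{A+BC+BD+Q}(1 − q^B) + q^{A+BC+BD+Q+B+CD} ] = q^{T_i + T_j + T_k + T_l} / ((q)_i (q)_j (q)_k (q)_l), where the sum is over all nonnegative integers A, B, C, D, AB, AC, AD, BC, BD, CD, Q satisfying i = A + AB + AC + AD + Q, j = B + AB + BC + BD + Q, k = C + AC + BC + CD + Q, l = D + AD + BD + CD + Q, and where τ = A + B + C + D + AB + AC + AD + BC + BD + CD. -/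
open PowerSeries

/-- The `n`-th triangular number `T_n = n(n+1)/2`. -/
def tri (n : ℕ) : ℕ := n * (n + 1) / 2

/-- The `q`-Pochhammer symbol `(q)_n = ∏_{m=1}^{n} (1 − q^m)` as a formal power series. -/
noncomputable def qPoch (n : ℕ) : PowerSeries ℚ :=
  ∏ m ∈ Finset.range n, (1 - (X : PowerSeries ℚ) ^ (m + 1))


/-- The indeterminate `q`. -/
local notation "q" => (PowerSeries.X : PowerSeries ℚ)

lemma tri_succ (n : ℕ) : tri (n + 1) = tri n + (n + 1) := by
  unfold tri
  rw [show (n + 1) * (n + 1 + 1) = n * (n + 1) + (n + 1) * 2 by ring,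
    Nat.add_mul_div_right _ _ two_pos]

lemma two_mul_tri (n : ℕ) : 2 * tri n = n * (n + 1) :=
  Nat.mul_div_cancel' (Nat.even_mul_succ_self n).two_dvd

lemma tri_eq_tri_pred_add (n : ℕ) : tri n = tri (n - 1) + n := by
  cases n with
  | zero => rfl
  | succ n => exact tri_succ n

lemma qPoch_zero_inv : (qPoch 0)⁻¹ = 1 := by
  simp [qPoch]

lemma one_sub_mul_qPoch_succ_inv (n : ℕ) :
    (1 - q ^ (n + 1)) * (qPoch (n + 1))⁻¹ = (qPoch n)⁻¹ := by
  have h : qPoch (n + 1) = qPoch n * (1 - q ^ (n + 1)) := by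
    simp [qPoch, Finset.prod_range_succ]
  rw [h, PowerSeries.mul_inv_rev, ← mul_assoc, PowerSeries.mul_inv_cancel _ (by simp), one_mul]

lemma one_sub_q_pow_ne_zero (n : ℕ) : 1 - q ^ (n + 1) ≠ 0 := by
  intro h
  simpa using congrArg PowerSeries.constantCoeff h

/-! ### Formal power series whose coefficients are products -/

/-- The formal power series `∏ r, ∑ n, f r n * X r ^ n`. -/
noncomputable def prodSeries {σ R : Type*} [Fintype σ] [CommRing R] (f : σ → ℕ → R) :
    MvPowerSeries σ R :=
  fun v => ∏ r, f r (v r)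

lemma coeff_prodSeries {σ R : Type*} [Fintype σ] [CommRing R] (f : σ → ℕ → R) (v : σ →₀ ℕ) :
    MvPowerSeries.coeff v (prodSeries f) = ∏ r, f r (v r) := rfl

lemma prodSeries_eq_one_add_mul {σ R : Type*} [Fintype σ] [DecidableEq σ] [CommRing R]
    {f g : σ → ℕ → R} (r : σ) (c : R)
    (hne : ∀ s ≠ r, g s = f s) (hzero : g r 0 = f r 0)
    (hsucc : ∀ n, g r (n + 1) = f r (n + 1) + c * f r n) :
    prodSeries g = (1 + MvPowerSeries.C c * MvPowerSeries.X r) * prodSeries f := by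
  ext v
  rw [add_mul, one_mul, mul_assoc, map_add, MvPowerSeries.coeff_C_mul, MvPowerSeries.X_def,
    MvPowerSeries.coeff_monomial_mul]
  simp only [coeff_prodSeries, one_mul]
  have hsplit (h : σ → ℕ → R) (w : σ →₀ ℕ) :
      ∏ s, h s (w s) = h r (w r) * ∏ s ∈ Finset.univ.erase r, h s (w s) :=
    (Finset.mul_prod_erase _ (fun s => h s (w s)) (Finset.mem_univ r)).symm
  rw [hsplit g, hsplit f v, hsplit f (v - _)]
  have hg : ∏ s ∈ Finset.univ.erase r, g s (v s) = ∏ s ∈ Finset.univ.erase r, f s (v s) :=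
    Finset.prod_congr rfl fun s hs => by rw [hne s (Finset.ne_of_mem_erase hs)]
  have hf : ∏ s ∈ Finset.univ.erase r, f s ((v - Finsupp.single r 1 : σ →₀ ℕ) s) =
      ∏ s ∈ Finset.univ.erase r, f s (v s) :=
    Finset.prod_congr rfl fun s hs => by
      simp [(Finset.ne_of_mem_erase hs).symm]
  rw [hg, hf]
  rcases hv : v r with _ | n
  · have : ¬ Finsupp.single r 1 ≤ v := by simp [Finsupp.single_le_iff, hv]
    simp [this, hzero]
  · have : Finsupp.single r 1 ≤ v := by simp [Finsupp.single_le_iff, hv]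
    simp only [this, if_true, Finsupp.tsub_apply, hv, Finsupp.single_eq_same,
      Nat.add_sub_cancel, hsucc]
    ring

/-! ### The generating function

The variables `A, B, C, D, AB, AC, AD, BC, BD, CD, Q` are numbered `0, …, 10`.  Four variables
`x₀, …, x₃` mark `i, j, k, l`, and a further variable `t`, in which the coefficients are
polynomials, marks `τ + 2 Q`. -/

/-- The exponents of `x₀, …, x₃` attached to each of the summation variables. -/
def markExp : Fin 11 → Fin 4 → ℕ :=
  ![![1, 0, 0, 0], ![0, 1, 0, 0], ![0, 0, 1, 0], ![0, 0, 0, 1],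
    ![1, 1, 0, 0], ![1, 0, 1, 0], ![1, 0, 0, 1], ![0, 1, 1, 0], ![0, 1, 0, 1], ![0, 0, 1, 1],
    ![1, 1, 1, 1]]

/-- The exponent of `t` attached to each of the summation variables. -/
def tExp : Fin 11 → ℕ := ![1, 1, 1, 1, 1, 1, 1, 1, 1, 1, 2]

/-- Power series in `x₀, …, x₃` whose coefficients are polynomials in `t` over `ℚ⟦q⟧`. -/
abbrev MarkedSeries : Type := MvPowerSeries (Fin 4) (Polynomial (PowerSeries ℚ))

/-- The monomial in `x₀, …, x₃, t` attached to each of the summation variables. -/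
noncomputable def mark (r : Fin 11) : MarkedSeries :=
  (∏ p, MvPowerSeries.X p ^ markExp r p) * MvPowerSeries.C (Polynomial.X ^ tExp r)

lemma hasSubst_mark : MvPowerSeries.HasSubst mark := by
  apply MvPowerSeries.hasSubst_of_constantCoeff_zero
  intro r
  fin_cases r <;> simp [mark, markExp, Fin.prod_univ_four]

lemma prod_X_pow_eq_monomial {σ R : Type*} [Fintype σ] [CommRing R] (n : σ →₀ ℕ) :
    ∏ p, (MvPowerSeries.X p : MvPowerSeries σ R) ^ n p = MvPowerSeries.monomial n 1 := by
  rw [MvPowerSeries.monomial_one_eq, Finsupp.prod_fintype _ _ (by simp)]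

/-- The exponents of `x₀, …, x₃` in the monomial attached to a tuple of summation variables. -/
noncomputable def totalMark (v : Fin 11 →₀ ℕ) : Fin 4 →₀ ℕ :=
  Finsupp.equivFunOnFinite.symm fun p => ∑ r, v r * markExp r p

lemma totalMark_apply (v : Fin 11 →₀ ℕ) (p : Fin 4) :
    totalMark v p = ∑ r, v r * markExp r p := rfl

/-- The exponent of `t` in the monomial attached to a tuple of summation variables. -/
def totalT (v : Fin 11 →₀ ℕ) : ℕ := ∑ r, v r * tExp r

lemma prod_mark_pow (v : Fin 11 →₀ ℕ) :
    (v.prod fun r n => mark r ^ n) =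
      MvPowerSeries.monomial (totalMark v) (Polynomial.X ^ totalT v) := by
  rw [Finsupp.prod_fintype _ _ (by simp)]
  simp only [mark, mul_pow, Finset.prod_mul_distrib, ← Finset.prod_pow, ← map_pow, ← pow_mul]
  rw [Finset.prod_comm]
  simp only [Finset.prod_pow_eq_pow_sum, ← map_prod, mul_comm _ (v _)]
  simp only [← totalMark_apply]
  rw [prod_X_pow_eq_monomial, ← MvPowerSeries.monomial_zero_eq_C_apply,
    MvPowerSeries.monomial_mul_monomial]
  simp [totalT]

open Classical in
lemma coeff_subst_mark (Z : MvPowerSeries (Fin 11) (PowerSeries ℚ)) (m : Fin 4 →₀ ℕ) :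
    MvPowerSeries.coeff m (MvPowerSeries.subst mark Z) =
      ∑ᶠ v, MvPowerSeries.coeff v Z •
        (if m = totalMark v then
          (Polynomial.X : Polynomial (PowerSeries ℚ)) ^ totalT v else 0) := by
  rw [MvPowerSeries.coeff_subst hasSubst_mark]
  simp only [prod_mark_pow, MvPowerSeries.coeff_monomial]

lemma hasFiniteSupport_subst_mark (Z : MvPowerSeries (Fin 11) (PowerSeries ℚ))
    (m : Fin 4 →₀ ℕ) :
    Function.HasFiniteSupport fun v : Fin 11 →₀ ℕ => MvPowerSeries.coeff v Z •
      (if m = totalMark v then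
        (Polynomial.X : Polynomial (PowerSeries ℚ)) ^ totalT v else 0) := by
  classical
  simpa only [prod_mark_pow, MvPowerSeries.coeff_monomial] using
    MvPowerSeries.coeff_subst_finite hasSubst_mark Z m

/-! ### The functional `t ^ n ↦ q ^ T_n` -/

/-- The `ℚ⟦q⟧`-linear functional on polynomials in `t` that maps `t ^ n` to `q ^ T_n`. -/
noncomputable def triFunctional :
    Polynomial (PowerSeries ℚ) →ₗ[PowerSeries ℚ] PowerSeries ℚ :=
  Polynomial.lsum fun n => LinearMap.mulLeft (PowerSeries ℚ) (q ^ tri n)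

lemma triFunctional_X_pow (n : ℕ) : triFunctional (Polynomial.X ^ n) = q ^ tri n := by
  simp [triFunctional, Polynomial.lsum_apply, ← Polynomial.monomial_one_right_eq_X_pow]

/-- The substitution `t ↦ q t`. -/
noncomputable def scaleT : Polynomial (PowerSeries ℚ) →+* Polynomial (PowerSeries ℚ) :=
  Polynomial.compRingHom (Polynomial.C q * Polynomial.X)

lemma triFunctional_X_mul (f : Polynomial (PowerSeries ℚ)) :
    triFunctional (Polynomial.X * f) = q * triFunctional (scaleT f) := by
  induction f using Polynomial.induction_on' with
  | add f g hf hg => simp only [mul_add, map_add, hf, hg]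
  | monomial n a =>
    have h₁ : Polynomial.X * Polynomial.monomial n a =
        a • (Polynomial.X ^ (n + 1) : Polynomial (PowerSeries ℚ)) := by
      rw [← Polynomial.C_mul_X_pow_eq_monomial, Polynomial.smul_eq_C_mul]
      ring
    have h₂ : scaleT (Polynomial.monomial n a) =
        (a * q ^ n) • (Polynomial.X ^ n : Polynomial (PowerSeries ℚ)) := by
      simp [scaleT, Polynomial.smul_eq_C_mul, mul_pow, mul_assoc]
    rw [h₁, h₂, map_smul, map_smul, triFunctional_X_pow, triFunctional_X_pow, tri_succ]
    simp only [smul_eq_mul]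
    ring

/-! ### The products in the generating function -/

/-- Whether a summation variable is one of `AB, AC, AD, BC, BD, CD`. -/
def IsPair (r : Fin 11) : Prop := 4 ≤ r ∧ r ≤ 9

instance : DecidablePred IsPair := fun r => inferInstanceAs (Decidable (4 ≤ r ∧ r ≤ 9))

/-- The factor of the summand that depends on the `r`-th summation variable, twisted by
`q ^ (s r * n)`. -/
noncomputable def factor (s : Fin 11 → ℕ) (r : Fin 11) (n : ℕ) : PowerSeries ℚ :=
  q ^ (s r * n) * ((if IsPair r then q ^ tri (n - 1) else 1) * (qPoch n)⁻¹)

/-- With `u r` the monomial attached to the `r`-th summation variable, this is the product of the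
`1 / (q ^ s r * u r; q)_∞` over `A, B, C, D, Q` and of the `(-q ^ s r * u r; q)_∞` over
`AB, …, CD`. -/
noncomputable def qProduct (s : Fin 11 → ℕ) : MarkedSeries :=
  MvPowerSeries.subst mark (prodSeries (factor s))

/-- Elements of `ℚ⟦q⟧` as constants. -/
noncomputable def constant : PowerSeries ℚ →+* MarkedSeries :=
  MvPowerSeries.C.comp Polynomial.C

lemma subst_mark_one_add_mul (c : PowerSeries ℚ) (r : Fin 11)
    (Z : MvPowerSeries (Fin 11) (PowerSeries ℚ)) :
    MvPowerSeries.subst mark ((1 + MvPowerSeries.C c * MvPowerSeries.X r) * Z) =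
      (1 + constant c * mark r) * MvPowerSeries.subst mark Z := by
  have h : MvPowerSeries.substAlgHom hasSubst_mark (MvPowerSeries.C c) = constant c := by
    simpa only [MvPowerSeries.algebraMap_apply, Polynomial.algebraMap_apply,
      Algebra.algebraMap_self, RingHom.id_apply, constant, RingHom.comp_apply] using
      (MvPowerSeries.substAlgHom hasSubst_mark).commutes c
  simp only [← MvPowerSeries.substAlgHom_apply hasSubst_mark, map_mul, map_add, map_one, h,
    MvPowerSeries.substAlgHom_X]

lemma qProduct_of_not_isPair {s s' : Fin 11 → ℕ} (r : Fin 11) (hr : ¬ IsPair r)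
    (h : s' = s + Pi.single r 1) :
    qProduct s' = (1 - constant (q ^ s r) * mark r) * qProduct s := by
  rw [qProduct, prodSeries_eq_one_add_mul (f := factor s) r (-q ^ s r), subst_mark_one_add_mul,
    map_neg, qProduct]
  · ring
  · intro i hi
    funext n
    simp [factor, h, hi]
  · simp [factor]
  · intro n
    simp only [factor, h, hr, if_false, one_mul, Pi.add_apply, Pi.single_eq_same]
    rw [← one_sub_mul_qPoch_succ_inv n]
    ring

lemma qProduct_of_isPair {s s' : Fin 11 → ℕ} (r : Fin 11) (hr : IsPair r)
    (h : s' = s + Pi.single r 1) :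
    qProduct s = (1 + constant (q ^ s r) * mark r) * qProduct s' := by
  rw [qProduct, prodSeries_eq_one_add_mul (f := factor s') r (q ^ s r), subst_mark_one_add_mul,
    qProduct]
  · intro i hi
    funext n
    simp [factor, h, hi]
  · simp [factor]
  · intro n
    simp only [factor, h, hr, if_true, Pi.add_apply, Pi.single_eq_same]
    rw [← one_sub_mul_qPoch_succ_inv n, Nat.add_sub_cancel, tri_eq_tri_pred_add n]
    ring

lemma qProduct_of_forall_not_isPair {s s' : Fin 11 → ℕ} (S : Finset (Fin 11))
    (hS : ∀ r ∈ S, ¬ IsPair r) (h : s' = fun r => s r + if r ∈ S then 1 else 0) :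
    qProduct s' = (∏ r ∈ S, (1 - constant (q ^ s r) * mark r)) * qProduct s := by
  induction S using Finset.induction_on generalizing s' with
  | empty => simp [h]
  | insert r S hr ih =>
    rw [Finset.prod_insert hr, mul_assoc,
      ← ih (fun i hi => hS i (Finset.mem_insert_of_mem hi)) rfl,
      qProduct_of_not_isPair (s := fun i => s i + if i ∈ S then 1 else 0) r
        (hS r (Finset.mem_insert_self r S))]
    · simp [hr]
    · funext i
      by_cases hi : i = r
      · simp [h, hi, hr]
      · simp [h, hi]

lemma qProduct_of_forall_isPair {s s' : Fin 11 → ℕ} (S : Finset (Fin 11))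
    (hS : ∀ r ∈ S, IsPair r) (h : s' = fun r => s r + if r ∈ S then 1 else 0) :
    qProduct s = (∏ r ∈ S, (1 + constant (q ^ s r) * mark r)) * qProduct s' := by
  induction S using Finset.induction_on generalizing s' with
  | empty => simp [h]
  | insert r S hr ih =>
    rw [Finset.prod_insert hr,
      ih (fun i hi => hS i (Finset.mem_insert_of_mem hi)) rfl,
      qProduct_of_isPair (s := fun i => s i + if i ∈ S then 1 else 0) (s' := s') r
        (hS r (Finset.mem_insert_self r S))]
    · simp only [hr, if_false, add_zero]
      ring
    · funext i
      by_cases hi : i = r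
      · simp [h, hi, hr]
      · simp [h, hi]

/-- The substitution `x_p ↦ q x_p`. -/
noncomputable def scaleX (p : Fin 4) : MarkedSeries →+* MarkedSeries :=
  MvPowerSeries.rescale (Pi.mulSingle p (Polynomial.C q))

lemma coeff_scaleX (p : Fin 4) (F : MarkedSeries) (m : Fin 4 →₀ ℕ) :
    MvPowerSeries.coeff m (scaleX p F) = q ^ m p • MvPowerSeries.coeff m F := by
  rw [scaleX, MvPowerSeries.coeff_rescale, Finsupp.prod_fintype _ _ (by simp),
    Polynomial.smul_eq_C_mul, Fintype.prod_eq_single p (fun i hi => by simp [hi])]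
  simp

lemma scaleX_C (p : Fin 4) (a : Polynomial (PowerSeries ℚ)) :
    scaleX p (MvPowerSeries.C a) = MvPowerSeries.C a := by
  classical
  ext1 m
  rw [coeff_scaleX, MvPowerSeries.coeff_C]
  split_ifs with h <;> simp [h]

lemma scaleX_X (p i : Fin 4) :
    scaleX p (MvPowerSeries.X i) =
      if i = p then constant q * MvPowerSeries.X i else MvPowerSeries.X i := by
  classical
  ext1 m
  rw [coeff_scaleX, MvPowerSeries.coeff_X]
  split_ifs with h₁ h₂ h₂ <;>
    simp [h₁, h₂, constant, MvPowerSeries.coeff_C_mul, MvPowerSeries.coeff_X,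
      Polynomial.smul_eq_C_mul]
  all_goals simp_all

lemma scaleX_qProduct (p : Fin 4) (s : Fin 11 → ℕ) :
    scaleX p (qProduct s) = qProduct fun r => s r + markExp r p := by
  classical
  ext1 m
  simp only [coeff_scaleX, qProduct, coeff_subst_mark]
  rw [smul_finsum' _ (hasFiniteSupport_subst_mark _ _)]
  refine finsum_congr fun v => ?_
  split_ifs with h
  · rw [smul_smul]
    congr 1
    simp only [coeff_prodSeries, factor, Finset.prod_mul_distrib, h, totalMark_apply,
      ← Finset.prod_pow_eq_pow_sum, add_mul, pow_add]
    simp only [mul_comm (v _)]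
    ring
  · simp

lemma map_scaleT_qProduct (s : Fin 11 → ℕ) :
    MvPowerSeries.map scaleT (qProduct s) = qProduct fun r => s r + tExp r := by
  classical
  ext1 m
  simp only [MvPowerSeries.coeff_map, qProduct, coeff_subst_mark]
  rw [map_finsum _ (hasFiniteSupport_subst_mark _ _)]
  refine finsum_congr fun v => ?_
  split_ifs with h
  · have hX : scaleT (Polynomial.X ^ totalT v) =
        q ^ totalT v • (Polynomial.X ^ totalT v : Polynomial (PowerSeries ℚ)) := by
      simp [scaleT, Polynomial.smul_eq_C_mul, mul_pow]
    have hs (a : PowerSeries ℚ) (f : Polynomial (PowerSeries ℚ)) :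
        scaleT (a • f) = a • scaleT f := by
      simp [scaleT, Polynomial.smul_eq_C_mul]
    rw [hs, hX, smul_smul]
    congr 1
    simp only [coeff_prodSeries, factor, Finset.prod_mul_distrib, totalT,
      ← Finset.prod_pow_eq_pow_sum, add_mul, pow_add]
    simp only [mul_comm (v _)]
    ring
  · simp

lemma mark_eq : mark =
    let x : Fin 4 → MarkedSeries := MvPowerSeries.X
    let t : MarkedSeries := MvPowerSeries.C Polynomial.X
    ![x 0 * t, x 1 * t, x 2 * t, x 3 * t, x 0 * x 1 * t, x 0 * x 2 * t, x 0 * x 3 * t,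
      x 1 * x 2 * t, x 1 * x 3 * t, x 2 * x 3 * t, x 0 * x 1 * x 2 * x 3 * t ^ 2] := by
  funext r
  fin_cases r <;> simp [mark, markExp, tExp, Fin.prod_univ_four]

/-- The polynomial that the bracket in the key identity contributes to the generating function. -/
def numerator {R : Type*} [CommRing R] (x y z w t : R) : R :=
  1 + (y * z * w + x * z * w + x * y * w + x * y * z - x * y * z * w) * t ^ 2 +
    ((x + y + z + w) * (x * y * z * w) - x * y * z * w) * t ^ 3 + (x * y * z * w) ^ 2 * t ^ 5

/-- The series with product coefficients whose combination gives the summand. -/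
noncomputable def summandSeries : MvPowerSeries (Fin 11) (PowerSeries ℚ) :=
  prodSeries (factor ![0, 0, 0, 0, 1, 1, 1, 0, 0, 0, 0]) -
    prodSeries (factor ![1, 0, 0, 0, 1, 1, 1, 0, 0, 0, 0]) +
    prodSeries (factor ![1, 0, 0, 0, 1, 1, 1, 1, 1, 0, 1]) -
    prodSeries (factor ![1, 1, 0, 0, 1, 1, 1, 1, 1, 0, 1]) +
    prodSeries (factor ![1, 1, 0, 0, 1, 1, 1, 1, 1, 1, 1])

/-- The generating function of the left-hand side, before `t ^ n` is replaced by `q ^ T_n`. -/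
noncomputable def genFun : MarkedSeries := MvPowerSeries.subst mark summandSeries

lemma genFun_eq : genFun =
    numerator (MvPowerSeries.X 0) (MvPowerSeries.X 1) (MvPowerSeries.X 2) (MvPowerSeries.X 3)
      (MvPowerSeries.C Polynomial.X) * qProduct ![0, 0, 0, 0, 1, 1, 1, 1, 1, 1, 0] := by
  have h : genFun = qProduct ![0, 0, 0, 0, 1, 1, 1, 0, 0, 0, 0] -
      qProduct ![1, 0, 0, 0, 1, 1, 1, 0, 0, 0, 0] + qProduct ![1, 0, 0, 0, 1, 1, 1, 1, 1, 0, 1] -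
      qProduct ![1, 1, 0, 0, 1, 1, 1, 1, 1, 0, 1] +
      qProduct ![1, 1, 0, 0, 1, 1, 1, 1, 1, 1, 1] := by
    simp only [genFun, summandSeries, qProduct, ← MvPowerSeries.substAlgHom_apply hasSubst_mark,
      map_add, map_sub]
  have h_A : qProduct ![1, 0, 0, 0, 1, 1, 1, 0, 0, 0, 0] = _ :=
    qProduct_of_not_isPair (s := ![0, 0, 0, 0, 1, 1, 1, 0, 0, 0, 0]) 0 (by decide) (by decide)
  have h_pairs : qProduct ![0, 0, 0, 0, 1, 1, 1, 0, 0, 0, 0] = _ :=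
    qProduct_of_forall_isPair (s' := ![0, 0, 0, 0, 1, 1, 1, 1, 1, 1, 0])
      {7, 8, 9} (by decide) (by decide)
  have h_CD : qProduct ![1, 0, 0, 0, 1, 1, 1, 1, 1, 0, 1] = _ :=
    qProduct_of_isPair (s' := ![1, 0, 0, 0, 1, 1, 1, 1, 1, 1, 1]) 9 (by decide) (by decide)
  have h_B_CD : qProduct ![1, 1, 0, 0, 1, 1, 1, 1, 1, 0, 1] = _ :=
    qProduct_of_isPair (s' := ![1, 1, 0, 0, 1, 1, 1, 1, 1, 1, 1]) 9 (by decide) (by decide)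
  have h_B : qProduct ![1, 1, 0, 0, 1, 1, 1, 1, 1, 1, 1] = _ :=
    qProduct_of_not_isPair (s := ![1, 0, 0, 0, 1, 1, 1, 1, 1, 1, 1]) 1 (by decide) (by decide)
  have h_A_Q : qProduct ![1, 0, 0, 0, 1, 1, 1, 1, 1, 1, 1] = _ :=
    qProduct_of_forall_not_isPair (s := ![0, 0, 0, 0, 1, 1, 1, 1, 1, 1, 0])
      {0, 10} (by decide) (by decide)
  rw [h, h_A, h_CD, h_B_CD, h_B, h_A_Q, h_pairs]
  simp [mark_eq, numerator]
  ring

/-- The algebraic identity behind the `q`-difference equation of the generating function. -/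
lemma numerator_identity {R : Type*} [CommRing R] (x y z w t c : R) :
    numerator x y z w t *
        ((1 + c * (x * y * t)) * (1 + c * (x * z * t)) * (1 + c * (x * w * t))) -
      (1 + c * x) * (numerator (c * x) y z w t * ((1 - x * t) * (1 - x * y * z * w * t ^ 2))) =
    t * (x * ((1 + c * (x * y * t)) * (1 + c * (x * z * t)) * (1 + c * (x * w * t)) *
        (1 + y * z * t) * (1 + y * w * t) * (1 + z * w * t))) -
      c * (x * ((1 - x * t) * (1 - y * t) * (1 - z * t) * (1 - w * t) *
        (1 - x * y * z * w * t ^ 2) * (1 - c * (x * y * z * w * t ^ 2)))) := by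
  unfold numerator
  ring

lemma genFun_functional_eq (p : Fin 4) : ∃ H : MarkedSeries,
    genFun - (1 + constant q * MvPowerSeries.X p) * scaleX p genFun =
      MvPowerSeries.C Polynomial.X * (MvPowerSeries.X p * H) -
        constant q * (MvPowerSeries.X p * MvPowerSeries.map scaleT H) := by
  let s₀ : Fin 11 → ℕ := fun r => if IsPair r ∧ markExp r p = 1 then 1 else 0
  let s₁ : Fin 11 → ℕ := ![0, 0, 0, 0, 1, 1, 1, 1, 1, 1, 0]
  let s₂ : Fin 11 → ℕ := fun r => s₀ r + s₁ r
  have h_cert : qProduct s₀ = _ := qProduct_of_forall_isPair (s' := s₁)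
    {r | IsPair r ∧ markExp r p = 0} (by simp +contextual) (by revert p; decide)
  have h_base : qProduct s₁ = _ := qProduct_of_forall_isPair (s' := s₂)
    {r | IsPair r ∧ markExp r p = 1} (by simp +contextual) (by clear h_cert; revert p; decide)
  have h_scaleX : scaleX p (qProduct s₁) = _ := (scaleX_qProduct p s₁).trans
    (qProduct_of_forall_not_isPair (s := s₂)
      {r | ¬ IsPair r ∧ markExp r p = 1} (by simp +contextual)
      (by clear h_cert h_base; revert p; decide))
  have h_scaleT : MvPowerSeries.map scaleT (qProduct s₀) = _ := (map_scaleT_qProduct s₀).trans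
    (qProduct_of_not_isPair (s := fun r => s₂ r + if r ∈ ({r | ¬ IsPair r} : Finset (Fin 11))
      then 1 else 0) 10 (by decide) (by clear h_cert h_base h_scaleX; revert p; decide))
  rw [qProduct_of_forall_not_isPair (s := s₂) {r | ¬ IsPair r} (by simp) rfl] at h_scaleT
  refine ⟨qProduct s₀, ?_⟩
  rw [genFun_eq, map_mul, h_scaleT, h_scaleX, h_cert, h_base]
  have key := numerator_identity (MvPowerSeries.X p) (MvPowerSeries.X (p.succAbove 0))
    (MvPowerSeries.X (p.succAbove 1)) (MvPowerSeries.X (p.succAbove 2))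
    (MvPowerSeries.C Polynomial.X) (constant q)
  generalize qProduct s₂ = Ψ
  fin_cases p <;>
  · simp [numerator, scaleX_X, scaleX_C, mark_eq, Finset.prod_filter, Fin.prod_univ_succ, IsPair,
      markExp, s₀, s₁, s₂, Fin.succAbove, Fin.le_def, Fin.lt_def] at key ⊢
    linear_combination Ψ * key

/-- The coefficient of `x₀ ^ m₀ ⋯ x₃ ^ m₃` in the generating function, with `t ^ n` replaced by
`q ^ T_n`. -/
noncomputable def keySum (m : Fin 4 →₀ ℕ) : PowerSeries ℚ :=
  triFunctional (MvPowerSeries.coeff m genFun)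

open Classical in
/-- The term of the key sum for the tuple `v` of summation variables. -/
noncomputable def keyTerm (m : Fin 4 →₀ ℕ) (v : Fin 11 →₀ ℕ) : PowerSeries ℚ :=
  if m = totalMark v then MvPowerSeries.coeff v summandSeries * q ^ tri (totalT v) else 0

open Classical in
lemma triFunctional_smul_ite (m : Fin 4 →₀ ℕ) (v : Fin 11 →₀ ℕ) :
    triFunctional (MvPowerSeries.coeff v summandSeries •
      (if m = totalMark v then (Polynomial.X : Polynomial (PowerSeries ℚ)) ^ totalT v else 0)) =
    keyTerm m v := by
  rw [map_smul, keyTerm]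
  split_ifs <;> simp [triFunctional_X_pow]

lemma keySum_eq_finsum (m : Fin 4 →₀ ℕ) : keySum m = ∑ᶠ v, keyTerm m v := by
  classical
  rw [keySum, genFun, coeff_subst_mark, map_finsum _ (hasFiniteSupport_subst_mark _ _)]
  simp only [triFunctional_smul_ite]

lemma hasFiniteSupport_keyTerm (m : Fin 4 →₀ ℕ) : Function.HasFiniteSupport (keyTerm m) := by
  classical
  refine (hasFiniteSupport_subst_mark summandSeries m).subset fun v hv h => hv ?_
  rw [← triFunctional_smul_ite]
  exact (congrArg triFunctional h).trans (map_zero _)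

lemma totalMark_eq_zero_iff (v : Fin 11 →₀ ℕ) : 0 = totalMark v ↔ v = 0 := by
  constructor
  · intro h
    have h' (p : Fin 4) := (DFunLike.congr_fun h p).symm
    simp only [totalMark_apply, Finsupp.coe_zero, Pi.zero_apply, Finset.sum_eq_zero_iff,
      Finset.mem_univ, true_imp_iff, mul_eq_zero] at h'
    ext r
    have hr : ∃ p, markExp r p ≠ 0 := by
      revert r
      decide
    obtain ⟨p, hp⟩ := hr
    exact (h' p r).resolve_right hp
  · rintro rfl
    ext p
    simp [totalMark_apply]

lemma keySum_zero : keySum 0 = 1 := by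
  rw [keySum_eq_finsum, finsum_eq_single (keyTerm 0) 0 fun v hv => if_neg
    (mt (totalMark_eq_zero_iff v).1 hv), keyTerm, if_pos ((totalMark_eq_zero_iff 0).2 rfl)]
  simp only [summandSeries, map_add, map_sub, coeff_prodSeries]
  simp [factor, totalT, tri, qPoch_zero_inv]

lemma coeff_add_single_X_mul {σ R : Type*} [CommRing R] (p : σ) (m : σ →₀ ℕ)
    (F : MvPowerSeries σ R) :
    MvPowerSeries.coeff (m + Finsupp.single p 1) (MvPowerSeries.X p * F) =
      MvPowerSeries.coeff m F := by
  rw [MvPowerSeries.X_def, add_comm, MvPowerSeries.coeff_add_monomial_mul, one_mul]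

lemma keySum_add_single (p : Fin 4) (m : Fin 4 →₀ ℕ) :
    (1 - q ^ (m p + 1)) * keySum (m + Finsupp.single p 1) = q ^ (m p + 1) * keySum m := by
  obtain ⟨H, hH⟩ := genFun_functional_eq p
  have h := congrArg (fun F => triFunctional
    (MvPowerSeries.coeff (m + Finsupp.single p 1) F)) hH
  simp only [add_mul, one_mul, mul_assoc, constant, RingHom.comp_apply, map_sub, map_add,
    MvPowerSeries.coeff_C_mul, coeff_add_single_X_mul, coeff_scaleX, MvPowerSeries.coeff_map,
    ← Polynomial.smul_eq_C_mul, map_smul, smul_eq_mul, triFunctional_X_mul, sub_self,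
    Finsupp.add_apply, Finsupp.single_eq_same] at h
  unfold keySum
  linear_combination h

lemma keySum_eq_prod (m : Fin 4 →₀ ℕ) :
    keySum m = ∏ p, q ^ tri (m p) * (qPoch (m p))⁻¹ := by
  induction hn : m.degree generalizing m with
  | zero =>
    rw [Finsupp.degree_eq_zero_iff] at hn
    subst hn
    simp [keySum_zero, qPoch_zero_inv, tri]
  | succ n ih =>
    obtain ⟨p, hp⟩ : ∃ p, m p ≠ 0 := by
      by_contra! h
      rw [Finsupp.ext (g := 0) h] at hn
      simp at hn
    obtain ⟨m', rfl⟩ : ∃ m', m = m' + Finsupp.single p 1 :=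
      ⟨m - Finsupp.single p 1, (tsub_add_cancel_of_le
        (Finsupp.single_le_iff.2 (Nat.one_le_iff_ne_zero.2 hp))).symm⟩
    have hm' : m'.degree = n := by simpa using hn
    apply mul_left_cancel₀ (one_sub_q_pow_ne_zero (m' p))
    have hsplit (w : Fin 4 →₀ ℕ) : ∏ i, q ^ tri (w i) * (qPoch (w i))⁻¹ =
        q ^ tri (w p) * (qPoch (w p))⁻¹ *
          ∏ i ∈ Finset.univ.erase p, q ^ tri (w i) * (qPoch (w i))⁻¹ :=
      (Finset.mul_prod_erase _ (fun i => q ^ tri (w i) * (qPoch (w i))⁻¹) (Finset.mem_univ p)).symm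
    rw [keySum_add_single, ih m' hm', hsplit m', hsplit (m' + _)]
    have herase : ∏ i ∈ Finset.univ.erase p,
        q ^ tri ((m' + Finsupp.single p 1 : Fin 4 →₀ ℕ) i) *
          (qPoch ((m' + Finsupp.single p 1 : Fin 4 →₀ ℕ) i))⁻¹ =
          ∏ i ∈ Finset.univ.erase p, q ^ tri (m' i) * (qPoch (m' i))⁻¹ :=
      Finset.prod_congr rfl fun i hi => by simp [(Finset.ne_of_mem_erase hi).symm]
    rw [herase, Finsupp.add_apply, Finsupp.single_eq_same, tri_succ,
      ← one_sub_mul_qPoch_succ_inv (m' p)]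
    ring

/-! ### Iterated sums -/

lemma hasFiniteSupport_cons {M : Type*} [Zero M] {n : ℕ} {f : (Fin (n + 1) → ℕ) → M}
    (hf : Function.HasFiniteSupport f) (a : ℕ) :
    Function.HasFiniteSupport fun w : Fin n → ℕ => f (Fin.cons a w) :=
  hf.preimage (Fin.cons_right_injective (α := fun _ => ℕ) a).injOn

lemma finsum_cons {M : Type*} [AddCommMonoid M] {n : ℕ} {f : (Fin (n + 1) → ℕ) → M}
    (hf : Function.HasFiniteSupport f) :
    ∑ᶠ v, f v = ∑ᶠ (a : ℕ) (w : Fin n → ℕ), f (Fin.cons a w) := by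
  rw [← finsum_comp_equiv (Fin.consEquiv fun _ => ℕ)]
  exact finsum_curry (fun x : ℕ × (Fin n → ℕ) => f (Fin.cons x.1 x.2))
    (hf.preimage (Fin.consEquiv fun _ => ℕ).injective.injOn)

lemma tri_add_two_mul (n Q : ℕ) :
    tri (n + 2 * Q) = tri n + 4 * tri (Q - 1) + 3 * Q + 2 * Q * n := by
  have h₁ := two_mul_tri (n + 2 * Q)
  have h₂ := two_mul_tri n
  have h₃ := two_mul_tri Q
  have h₄ := tri_eq_tri_pred_add Q
  nlinarith

/-- A tuple of summation variables. -/
noncomputable def tuple {n : ℕ} (v : Fin n → ℕ) : Fin n →₀ ℕ := Finsupp.equivFunOnFinite.symm v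

lemma tuple_apply {n : ℕ} (v : Fin n → ℕ) (r : Fin n) : tuple v r = v r := rfl

lemma totalT_tuple (A B C D AB AC AD BC BD CD Q : ℕ) :
    totalT (tuple ![A, B, C, D, AB, AC, AD, BC, BD, CD, Q]) =
      A + B + C + D + AB + AC + AD + BC + BD + CD + 2 * Q := by
  simp [totalT, tExp, tuple_apply, Fin.sum_univ_succ]
  ring

lemma tuple_eq_totalMark_tuple_iff (i j k l A B C D AB AC AD BC BD CD Q : ℕ) :
    tuple ![i, j, k, l] = totalMark (tuple ![A, B, C, D, AB, AC, AD, BC, BD, CD, Q]) ↔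
      i = A + AB + AC + AD + Q ∧ j = B + AB + BC + BD + Q ∧
        k = C + AC + BC + CD + Q ∧ l = D + AD + BD + CD + Q := by
  simp [Finsupp.ext_iff, Fin.forall_fin_succ, totalMark_apply, tuple_apply, markExp,
    Fin.sum_univ_succ, add_assoc]

lemma coeff_summandSeries_mul (A B C D AB AC AD BC BD CD Q : ℕ) :
    MvPowerSeries.coeff
        (tuple ![A, B, C, D, AB, AC, AD, BC, BD, CD, Q]) summandSeries *
      q ^ tri (A + B + C + D + AB + AC + AD + BC + BD + CD + 2 * Q) =
    q ^ (tri (A + B + C + D + AB + AC + AD + BC + BD + CD) + tri AB + tri AC + tri AD +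
          (tri BC - BC) + (tri BD - BD) + (tri CD - CD) + 4 * tri (Q - 1) + 3 * Q +
          2 * Q * (A + B + C + D + AB + AC + AD + BC + BD + CD)) *
      ((1 - q ^ A) + q ^ (A + BC + BD + Q) * (1 - q ^ B) + q ^ (A + BC + BD + Q + B + CD)) *
      (qPoch A * qPoch B * qPoch C * qPoch D * qPoch AB * qPoch AC * qPoch AD *
        qPoch BC * qPoch BD * qPoch CD * qPoch Q)⁻¹ := by
  rw [tri_add_two_mul, tri_eq_tri_pred_add AB, tri_eq_tri_pred_add AC, tri_eq_tri_pred_add AD,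
    tri_eq_tri_pred_add BC, tri_eq_tri_pred_add BD, tri_eq_tri_pred_add CD]
  simp only [summandSeries, map_add, map_sub, coeff_prodSeries, Fin.prod_univ_succ,
    Fin.prod_univ_zero, factor, IsPair, tuple_apply, PowerSeries.mul_inv_rev,
    Nat.add_sub_cancel]
  simp [Fin.le_def]
  ring
/-- The four-parameter key identity of Alladi, Andrews, and Berkovich, as an identity of
formal power series in `q`.  The sum runs over all nonnegative integers
`A, B, C, D, AB, AC, AD, BC, BD, CD, Q` subject to the four linear constraints; the
exponent `T_τ + T_{AB} + T_{AC} + T_{AD} + (T_{BC} − BC) + (T_{BD} − BD) + (T_{CD} − CD)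
+ 4 T_{Q−1} + 3Q + 2Qτ` uses the convention `T_{−1} = 0` (realized by truncated
subtraction `Q − 1` in `ℕ`). -/
theorem aab_key_identity (i j k l : ℕ) :
    (∑ᶠ (A : ℕ) (B : ℕ) (C : ℕ) (D : ℕ) (AB : ℕ) (AC : ℕ) (AD : ℕ) (BC : ℕ) (BD : ℕ)
        (CD : ℕ) (Q : ℕ),
      if i = A + AB + AC + AD + Q ∧ j = B + AB + BC + BD + Q ∧
          k = C + AC + BC + CD + Q ∧ l = D + AD + BD + CD + Q then
        (X : PowerSeries ℚ) ^
            (tri (A + B + C + D + AB + AC + AD + BC + BD + CD) + tri AB + tri AC + tri AD +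
              (tri BC - BC) + (tri BD - BD) + (tri CD - CD) + 4 * tri (Q - 1) + 3 * Q +
              2 * Q * (A + B + C + D + AB + AC + AD + BC + BD + CD)) *
          ((1 - (X : PowerSeries ℚ) ^ A) +
            (X : PowerSeries ℚ) ^ (A + BC + BD + Q) * (1 - (X : PowerSeries ℚ) ^ B) +
            (X : PowerSeries ℚ) ^ (A + BC + BD + Q + B + CD)) *
          (qPoch A * qPoch B * qPoch C * qPoch D * qPoch AB * qPoch AC * qPoch AD *
            qPoch BC * qPoch BD * qPoch CD * qPoch Q)⁻¹
      else 0) =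
    (X : PowerSeries ℚ) ^ (tri i + tri j + tri k + tri l) *
      (qPoch i * qPoch j * qPoch k * qPoch l)⁻¹ := by
  have hf : Function.HasFiniteSupport fun v : Fin 11 → ℕ =>
      keyTerm (tuple ![i, j, k, l]) (tuple v) :=
    (hasFiniteSupport_keyTerm _).preimage Finsupp.equivFunOnFinite.symm.injective.injOn
  have hsum : keySum (tuple ![i, j, k, l]) =
      ∑ᶠ v : Fin 11 → ℕ, keyTerm (tuple ![i, j, k, l]) (tuple v) := by
    rw [keySum_eq_finsum]
    exact (finsum_comp_equiv Finsupp.equivFunOnFinite.symm).symm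
  have hprod : keySum (tuple ![i, j, k, l]) =
      (X : PowerSeries ℚ) ^ (tri i + tri j + tri k + tri l) *
      (qPoch i * qPoch j * qPoch k * qPoch l)⁻¹ := by
    rw [keySum_eq_prod]
    simp only [Fin.prod_univ_four, tuple_apply, Matrix.cons_val, PowerSeries.mul_inv_rev]
    ring
  rw [← hprod, hsum, finsum_cons hf]
  refine finsum_congr fun A => ?_
  replace hf := hasFiniteSupport_cons hf A
  rw [finsum_cons hf]
  refine finsum_congr fun B => ?_
  replace hf := hasFiniteSupport_cons hf B
  rw [finsum_cons hf]
  refine finsum_congr fun C => ?_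
  replace hf := hasFiniteSupport_cons hf C
  rw [finsum_cons hf]
  refine finsum_congr fun D => ?_
  replace hf := hasFiniteSupport_cons hf D
  rw [finsum_cons hf]
  refine finsum_congr fun AB => ?_
  replace hf := hasFiniteSupport_cons hf AB
  rw [finsum_cons hf]
  refine finsum_congr fun AC => ?_
  replace hf := hasFiniteSupport_cons hf AC
  rw [finsum_cons hf]
  refine finsum_congr fun AD => ?_
  replace hf := hasFiniteSupport_cons hf AD
  rw [finsum_cons hf]
  refine finsum_congr fun BC => ?_
  replace hf := hasFiniteSupport_cons hf BC
  rw [finsum_cons hf]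
  refine finsum_congr fun BD => ?_
  replace hf := hasFiniteSupport_cons hf BD
  rw [finsum_cons hf]
  refine finsum_congr fun CD => ?_
  replace hf := hasFiniteSupport_cons hf CD
  rw [finsum_cons hf]
  refine finsum_congr fun Q => ?_
  rw [finsum_unique, ← coeff_summandSeries_mul, ← totalT_tuple]
  simp only [← tuple_eq_totalMark_tuple_iff]
  change _ = keyTerm _ (tuple ![A, B, C, D, AB, AC, AD, BC, BD, CD, Q])
  rw [keyTerm]
end

section
/- For any primary-colored part l_p (with primary color p and size l ≥ 1) and any secondary-colored part k_q (with secondary color q and size k ≥ 2), the following are equivalent: (1) l_p ≫ α(k_q); (2) β((k+1)_q) ≻ (l−1)_p does not hold. -/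
/-- The four primary and six secondary colors, totally ordered by
`ab < ac < ad < a < bc < bd < b < cd < c < d`. -/
inductive C10 : Type
  | ab | ac | ad | a | bc | bd | b | cd | c | d
  deriving DecidableEq

/-- Index realizing the color order `ab < ac < ad < a < bc < bd < b < cd < c < d`. -/
def C10.idx : C10 → ℕ
  | .ab => 0
  | .ac => 1
  | .ad => 2
  | .a => 3
  | .bc => 4
  | .bd => 5
  | .b => 6
  | .cd => 7
  | .c => 8
  | .d => 9

/-- Whether a color is primary. -/
def C10.primary : C10 → Bool
  | .a => true
  | .b => true
  | .c => true
  | .d => true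
  | _ => false

/-- The lexicographic order `≻` on colored parts: `k_p ≻ l_q ↔ k − l ≥ χ(p ≤ q)`. -/
def Succ (x y : ℕ × C10) : Prop :=
  y.1 + (if x.2.idx ≤ y.2.idx then 1 else 0) ≤ x.1

/-- A colored part belongs to `P ∪ S`: positive size, and size at least 2 if the color is
secondary. -/
def InPS (x : ℕ × C10) : Prop :=
  0 < x.1 ∧ (x.2.primary = false → 2 ≤ x.1)

/-- The relation `≫`: `k_p ≫ l_q` iff `k_p ≽ (l+1)_q` when `p` or `q` is primary;
`k_p ≻ (l+1)_q` when `p, q` are secondary with `(p,q) ∉ {(cd,ab),(ad,bc)}`; and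
`k_p ≻ l_q` when `(p,q) ∈ {(cd,ab),(ad,bc)}`. -/
def GG (x y : ℕ × C10) : Prop :=
  if (x.2 = C10.cd ∧ y.2 = C10.ab) ∨ (x.2 = C10.ad ∧ y.2 = C10.bc) then
    Succ x y
  else if x.2.primary ∨ y.2.primary then
    Succ x (y.1 + 1, y.2) ∨ x = (y.1 + 1, y.2)
  else
    Succ x (y.1 + 1, y.2)

/-- The smaller primary constituent of a secondary color (junk value on primary colors). -/
def C10.lo : C10 → C10
  | .ab => .a
  | .ac => .a
  | .ad => .a
  | .bc => .b
  | .bd => .b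
  | .cd => .c
  | x => x

/-- The larger primary constituent of a secondary color (junk value on primary colors). -/
def C10.hi : C10 → C10
  | .ab => .b
  | .ac => .c
  | .ad => .d
  | .bc => .c
  | .bd => .d
  | .cd => .d
  | x => x

/-- The upper half `α` of a secondary part: `α((2k)_pq) = k_q`, `α((2k+1)_pq) = (k+1)_p`. -/
def upperHalf (x : ℕ × C10) : ℕ × C10 :=
  if x.1 % 2 = 0 then (x.1 / 2, x.2.hi) else (x.1 / 2 + 1, x.2.lo)

/-- The lower half `β` of a secondary part: `β((2k)_pq) = k_p`, `β((2k+1)_pq) = k_q`. -/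
def lowerHalf (x : ℕ × C10) : ℕ × C10 :=
  if x.1 % 2 = 0 then (x.1 / 2, x.2.lo) else (x.1 / 2, x.2.hi)

theorem C10.idx_injective : Function.Injective C10.idx := by
  intro x y h
  cases x <;> cases y <;> first | rfl | cases h

/-- When the left part is primary, `≫` is the negation of the reversed order `≻` after lowering
the left part by one. -/
theorem gg_iff_not_succ_of_primary {l : ℕ} {p : C10} (hp : p.primary = true) (hl : 1 ≤ l)
    (y : ℕ × C10) : GG (l, p) y ↔ ¬ Succ y (l - 1, p) := by
  obtain ⟨n, r⟩ := y
  have hcd : p ≠ C10.cd := by rintro rfl; cases hp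
  have had : p ≠ C10.ad := by rintro rfl; cases hp
  have hidx : p = r ↔ p.idx = r.idx := C10.idx_injective.eq_iff.symm
  simp only [GG, Succ, hcd, had, hp, false_and, or_self, if_false, true_or, if_true,
    Prod.mk.injEq, hidx]
  split_ifs <;> omega

/-- The upper half of `k_q` is the lower half of `(k+1)_q`. -/
theorem upperHalf_eq_lowerHalf_succ (k : ℕ) (q : C10) :
    upperHalf (k, q) = lowerHalf (k + 1, q) := by
  rcases Nat.mod_two_eq_zero_or_one k with h | h
  · have h1 : (k + 1) % 2 ≠ 0 := by omega
    have h2 : (k + 1) / 2 = k / 2 := by omega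
    simp [upperHalf, lowerHalf, h, h1, h2]
  · have h1 : (k + 1) % 2 = 0 := by omega
    have h2 : (k + 1) / 2 = k / 2 + 1 := by omega
    simp [upperHalf, lowerHalf, h, h1, h2]

/-- Lemma 2.1, equation (2.16): for a primary part `l_p` (size `l ≥ 1`) and a secondary part
`k_q` (size `k ≥ 2`), `l_p ≫ α(k_q)` holds if and only if `β((k+1)_q) ≻ (l−1)_p` fails. -/
theorem ordering_primary_upper_half (l k : ℕ) (p q : C10)
    (hp : p.primary = true) (hq : q.primary = false) (hl : 1 ≤ l) (hk : 2 ≤ k) :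
    GG (l, p) (upperHalf (k, q)) ↔ ¬ Succ (lowerHalf (k + 1, q)) (l - 1, p) := by
  rw [upperHalf_eq_lowerHalf_succ]
  exact gg_iff_not_succ_of_primary hp hl _
end

section
/- For any secondary colors p and q, Δ(p,q) = min{ k − l : k, l ≥ 2 and β(k_p) ≻ α(l_q) }, where Δ(p,q) is the unique integer such that k_p ≫ l_q if and only if k − l ≥ Δ(p,q); explicitly, Δ(p,q) = 0 if (p,q) = (cd,ab), Δ(p,q) = 1 if (p,q) = (ad,bc) or p > q in the color order, and Δ(p,q) = 2 if p ≤ q in the color order and (p,q) ∉ {(cd,ab),(ad,bc)}. -/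
/-- The minimal difference `Δ(p,q)` between secondary parts: `Δ(cd,ab) = 0`;
`Δ(ad,bc) = 1` and `Δ(p,q) = 1` if `p > q` in the color order; `Δ(p,q) = 2` otherwise. -/
def Delta (p q : C10) : ℤ :=
  if p = C10.cd ∧ q = C10.ab then 0
  else if (p = C10.ad ∧ q = C10.bc) ∨ q.idx < p.idx then 1
  else 2

/-- The minimal difference is attained with the smaller part of size `2` or `3`. -/
theorem exists_succ_halves_sub_eq_Delta (p q : C10)
    (hp : p.primary = false) (hq : q.primary = false) :
    ∃ m n : ℕ, 2 ≤ m ∧ 2 ≤ n ∧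
      Succ (lowerHalf (m, p)) (upperHalf (n, q)) ∧ Delta p q = (m : ℤ) - n := by
  have witness (n : ℕ) (hn : 2 ≤ n) (e : ℕ) (he : Delta p q = e)
      (h : Succ (lowerHalf (n + e, p)) (upperHalf (n, q))) :
      ∃ m n : ℕ, 2 ≤ m ∧ 2 ≤ n ∧
        Succ (lowerHalf (m, p)) (upperHalf (n, q)) ∧ Delta p q = (m : ℤ) - n :=
    ⟨n + e, n, by omega, hn, h, by push_cast; omega⟩
  cases p <;> cases hp <;> cases q <;> cases hq <;>
    first
    | exact witness 2 (by decide) _ rfl (by unfold Succ; decide)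
    | exact witness 3 (by decide) _ rfl (by unfold Succ; decide)

/-- If `β(m_p) ≻ α(n_q)`, then `m - n` is at least `Delta p q`. -/
theorem Delta_le_sub_of_succ_halves (p q : C10)
    (hp : p.primary = false) (hq : q.primary = false) (m n : ℕ)
    (h : Succ (lowerHalf (m, p)) (upperHalf (n, q))) : Delta p q ≤ (m : ℤ) - n := by
  cases p <;> cases hp <;> cases q <;> cases hq <;>
    simp only [Succ, lowerHalf, upperHalf] at h <;>
    split_ifs at h <;> simp_all [C10.lo, C10.hi, C10.idx, Delta] <;> omega

/-- For secondary colors, `m_p ≫ n_q` if and only if `m - n` is at least `Delta p q`. -/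
theorem GG_iff_Delta_le_sub (p q : C10)
    (hp : p.primary = false) (hq : q.primary = false) (m n : ℕ) :
    GG (m, p) (n, q) ↔ Delta p q ≤ (m : ℤ) - n := by
  cases p <;> cases hp <;> cases q <;> cases hq <;>
    simp [GG, Succ, Delta, C10.idx, C10.primary] <;> omega

/-- Lemma 2.2, equation (2.17): for secondary colors `p, q`, the quantity `Δ(p,q)` — the
unique integer such that `k_p ≫ l_q ↔ k − l ≥ Δ(p,q)` — equals
`min{k − l : k, l ≥ 2 and β(k_p) ≻ α(l_q)}`. -/
theorem ordering_secondary_parts (p q : C10)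
    (hp : p.primary = false) (hq : q.primary = false) :
    IsLeast {d : ℤ | ∃ m n : ℕ, 2 ≤ m ∧ 2 ≤ n ∧
        Succ (lowerHalf (m, p)) (upperHalf (n, q)) ∧ d = (m : ℤ) - n} (Delta p q) ∧
      ∀ m n : ℕ, 2 ≤ m → 2 ≤ n → (GG (m, p) (n, q) ↔ Delta p q ≤ (m : ℤ) - n) := by
  refine ⟨⟨exists_succ_halves_sub_eq_Delta p q hp hq, ?_⟩,
    fun m n _ _ => GG_iff_Delta_le_sub p q hp hq m n⟩
  rintro _ ⟨m, n, _, _, h, rfl⟩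
  exact Delta_le_sub_of_succ_halves p q hp hq m n h
end

section
/- For any secondary-colored parts k_p and l_q (secondary colors p, q and sizes k, l ≥ 2): if β(k_p) ≻ β(l_q), then (k+1)_p ≫ l_q. -/
/-- Lemma 2.2, equation (2.18): for secondary parts `k_p`, `l_q` of sizes `k, l ≥ 2`,
if `β(k_p) ≻ β(l_q)` then `(k+1)_p ≫ l_q`. -/
theorem lower_halves_ordering (k l : ℕ) (p q : C10)
    (hp : p.primary = false) (hq : q.primary = false) (hk : 2 ≤ k) (hl : 2 ≤ l)
    (h : Succ (lowerHalf (k, p)) (lowerHalf (l, q))) :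
    GG (k + 1, p) (l, q) := by
  cases p <;> simp only [C10.primary, reduceCtorEq] at hp <;>
    cases q <;> simp only [C10.primary, reduceCtorEq] at hq <;>
    simp only [lowerHalf, Succ, GG] at h ⊢ <;>
    split_ifs at h <;>
    simp [C10.idx, C10.lo, C10.hi, C10.primary] at * <;> omega
end

section
/- For any secondary-colored parts k_p and l_q (secondary colors p, q and sizes k, l ≥ 2): if k_p ≫ l_q, then either β(k_p) ≻ α(l_q), or else all three of the following hold: α(l_q) + 1 ≫ α((k−1)_p), α((k−1)_p) ≻ β((k−1)_p), and β((k−1)_p) ≻ β(l_q). -/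
set_option maxHeartbeats 4000000 in
/-- Lemma 2.2, equation (2.19): for secondary parts `k_p`, `l_q` of sizes `k, l ≥ 2` with
`k_p ≫ l_q`, either `β(k_p) ≻ α(l_q)`, or else
`α(l_q) + 1 ≫ α((k−1)_p) ≻ β((k−1)_p) ≻ β(l_q)`. -/
theorem secondary_ordering_dichotomy (k l : ℕ) (p q : C10)
    (hp : p.primary = false) (hq : q.primary = false) (hk : 2 ≤ k) (hl : 2 ≤ l)
    (h : GG (k, p) (l, q)) :
    Succ (lowerHalf (k, p)) (upperHalf (l, q)) ∨
      (GG ((upperHalf (l, q)).1 + 1, (upperHalf (l, q)).2) (upperHalf (k - 1, p)) ∧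
        Succ (upperHalf (k - 1, p)) (lowerHalf (k - 1, p)) ∧
        Succ (lowerHalf (k - 1, p)) (lowerHalf (l, q))) := by
  have hparity : k % 2 = 0 ∧ (k - 1) % 2 = 1 ∨ k % 2 = 1 ∧ (k - 1) % 2 = 0 := by omega
  rcases hparity with ⟨hk₀, hk₁⟩ | ⟨hk₀, hk₁⟩ <;>
    rcases Nat.mod_two_eq_zero_or_one l with hl₀ | hl₀ <;>
    cases p <;> simp only [C10.primary, Bool.true_eq_false] at hp <;>
    cases q <;> simp only [C10.primary, Bool.true_eq_false] at hq <;>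
    simp [GG, Succ, upperHalf, lowerHalf, C10.idx, C10.lo, C10.hi, C10.primary,
      hk₀, hk₁, hl₀] at h ⊢ <;>
    omega
end

section
/- Let ν = (ν₁, …, ν_t) be a sequence of colored parts in P ∪ S with ν_i ≫ ν_{i+1} for all 1 ≤ i < t. Then for any i ∈ [1, t−2] such that ν_{i+1} ∈ S, ν_{i+2} ∈ P, and the pair of colors (c(ν_i), c(ν_{i+1})) ∉ {(ad,bc), (cd,ab)}, one has ν_i ≻ ν_{i+2} + 2. -/
/-- Lemma 2.3, equation (2.20): if `ν` is a sequence of parts of `P ∪ S` decreasing for `≫`,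
then for any three consecutive parts `x, y, z` with `y ∈ S`, `z ∈ P` and
`(c(x), c(y)) ∉ {(ad,bc), (cd,ab)}`, one has `x ≻ z + 2`. -/
theorem reversibility_inequality (ν : List (ℕ × C10))
    (hPS : ∀ x ∈ ν, InPS x) (hord : ν.Chain' GG)
    (x y z : ℕ × C10) (hinf : [x, y, z] <:+: ν)
    (hy : y.2.primary = false) (hz : z.2.primary = true)
    (hc : ¬ ((x.2 = C10.ad ∧ y.2 = C10.bc) ∨ (x.2 = C10.cd ∧ y.2 = C10.ab))) :
    Succ x (z.1 + 2, z.2) := by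
  have hchain : [x, y, z].IsChain GG := List.IsChain.infix hord hinf
  simp only [List.isChain_cons_cons, List.isChain_singleton, and_true] at hchain
  obtain ⟨hxy, hyz⟩ := hchain
  have hxy' : Succ x (y.1 + 1, y.2) := by
    rw [GG, if_neg fun h => hc h.symm] at hxy
    split_ifs at hxy with hp
    · rcases hxy with h | h
      · exact h
      · simp [h, hy] at hp
    · exact hxy
  have hyz' : Succ y (z.1 + 1, z.2) := by
    have hinert : ¬ ((y.2 = C10.cd ∧ z.2 = C10.ab) ∨ (y.2 = C10.ad ∧ z.2 = C10.bc)) := by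
      rintro (⟨-, h⟩ | ⟨-, h⟩) <;> simp [h, C10.primary] at hz
    rw [GG, if_neg hinert, if_pos (Or.inr hz)] at hyz
    rcases hyz with h | h
    · exact h
    · simp [h, hz] at hy
  simp only [Succ] at *
  split_ifs at * <;> omega
end

section
/- Let ν = (ν₁, …, ν_t) be a sequence of colored parts in P ∪ S with ν_i ≫ ν_{i+1} for all 1 ≤ i < t. Then the following are equivalent: (1) ν ∈ E₁, i.e., ν contains no three consecutive parts forming one of the forbidden patterns ((k+2)_cd,(k+2)_ab,k_c), ((k+2)_cd,(k+2)_ab,k_d), ((k+2)_ad,(k+1)_bc,k_a), except that (3_ad,2_bc,1_a) is allowed; (2) for every i ∈ [1, t−2] such that the pair (ν_i, ν_{i+1}) has the form ((k+1)_ad, k_bc) or (k_cd, k_ab) for some k, and (ν_i, ν_{i+1}) ≠ (3_ad, 2_bc), one has ν_i ≽ ν_{i+2} + 2 (i.e., ν_i ≻ ν_{i+2} + 2 or ν_i = ν_{i+2} + 2). -/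
/-- The forbidden patterns `((k+2)_cd, (k+2)_ab, k_c)`, `((k+2)_cd, (k+2)_ab, k_d)` and
`((k+2)_ad, (k+1)_bc, k_a)`, except that `(3_ad, 2_bc, 1_a)` is allowed. -/
def Forbidden (x y z : ℕ × C10) : Prop :=
  (x, y, z) ≠ ((3, C10.ad), (2, C10.bc), (1, C10.a)) ∧
    ((x.2 = C10.cd ∧ y.2 = C10.ab ∧ x.1 = y.1 ∧ x.1 = z.1 + 2 ∧
        (z.2 = C10.c ∨ z.2 = C10.d)) ∨
      (x.2 = C10.ad ∧ y.2 = C10.bc ∧ x.1 = y.1 + 1 ∧ x.1 = z.1 + 2 ∧ z.2 = C10.a))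

/-- Membership in `E₁`: a sequence of parts in `P ∪ S`, decreasing for `≫`, with no three
consecutive parts forming a forbidden pattern. -/
def InE1 (l : List (ℕ × C10)) : Prop :=
  (∀ x ∈ l, InPS x) ∧ l.Chain' GG ∧
    ∀ x y z : ℕ × C10, [x, y, z] <:+: l → ¬ Forbidden x y z

/-- For three consecutive parts with `y ≫ z`, avoiding the forbidden patterns amounts to the
difference condition `x ≽ z + 2` on the special pairs `(x, y)`. -/
theorem not_forbidden_iff_of_GG {x y z : ℕ × C10} (hyz : GG y z) :
    ¬ Forbidden x y z ↔
      (((x.2 = C10.ad ∧ y.2 = C10.bc ∧ x.1 = y.1 + 1) ∨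
          (x.2 = C10.cd ∧ y.2 = C10.ab ∧ x.1 = y.1)) →
        ¬ (x = (3, C10.ad) ∧ y = (2, C10.bc)) →
        (Succ x (z.1 + 2, z.2) ∨ x = (z.1 + 2, z.2))) := by
  obtain ⟨k, p⟩ := x
  obtain ⟨l, q⟩ := y
  obtain ⟨m, r⟩ := z
  by_cases hpq : (p = C10.ad ∧ q = C10.bc) ∨ (p = C10.cd ∧ q = C10.ab)
  · rcases hpq with ⟨rfl, rfl⟩ | ⟨rfl, rfl⟩ <;> cases r <;>
      simp [GG, Succ, Forbidden, C10.idx, C10.primary] at hyz ⊢ <;> omega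
  · simp only [Forbidden]
    tauto

/-- Lemma 2.3, second part: for a sequence `ν` of parts of `P ∪ S` decreasing for `≫`,
avoiding the forbidden patterns (i.e. `ν ∈ E₁`) is equivalent to: whenever three consecutive
parts `x, y, z` are such that `(x, y)` has the form `((k+1)_ad, k_bc)` or `(k_cd, k_ab)` and
`(x, y) ≠ (3_ad, 2_bc)`, one has `x ≽ z + 2`. -/
theorem characterization_E1 (ν : List (ℕ × C10))
    (hPS : ∀ x ∈ ν, InPS x) (hord : ν.Chain' GG) :
    (∀ x y z : ℕ × C10, [x, y, z] <:+: ν → ¬ Forbidden x y z) ↔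
      (∀ x y z : ℕ × C10, [x, y, z] <:+: ν →
        ((x.2 = C10.ad ∧ y.2 = C10.bc ∧ x.1 = y.1 + 1) ∨
          (x.2 = C10.cd ∧ y.2 = C10.ab ∧ x.1 = y.1)) →
        ¬ (x = (3, C10.ad) ∧ y = (2, C10.bc)) →
        (Succ x (z.1 + 2, z.2) ∨ x = (z.1 + 2, z.2))) := by
  have hGG : ∀ x y z : ℕ × C10, [x, y, z] <:+: ν → GG y z := fun x y z h => by
    have hc := List.IsChain.infix hord h
    simp only [List.isChain_cons_cons] at hc
    exact hc.2.1
  exact forall₃_congr fun x y z => forall_congr' fun h =>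
    not_forbidden_iff_of_GG (hGG x y z h)
end

section
/- For all nonnegative integers u, v, w, t, n, the number of partitions in E₁ of n with exactly u parts whose color contains a, exactly v parts whose color contains b, exactly w parts whose color contains c, and exactly t parts whose color contains d is equal to the number of AAB quaternary partitions of n with exactly u parts whose color contains a, exactly v parts whose color contains b, exactly w parts whose color contains c, and exactly t parts whose color contains d (where a part of color abcd contributes to all four counts). -/
/-- Colors containing `a`. -/
def C10.hasA : C10 → Bool
  | .a => true
  | .ab => true
  | .ac => true
  | .ad => true
  | _ => false

/-- Colors containing `b`. -/
def C10.hasB : C10 → Bool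
  | .b => true
  | .ab => true
  | .bc => true
  | .bd => true
  | _ => false

/-- Colors containing `c`. -/
def C10.hasC : C10 → Bool
  | .c => true
  | .ac => true
  | .bc => true
  | .cd => true
  | _ => false

/-- Colors containing `d`. -/
def C10.hasD : C10 → Bool
  | .d => true
  | .ad => true
  | .bd => true
  | .cd => true
  | _ => false

/-- The relation `▷`: `k_p ▷ l_q` iff `k − l ≥ 1 + χ(p < q)` when `p` or `q` is primary, and
`k − l ≥ 1 + χ(p ≤ q)` when `p` and `q` are both secondary. -/
def Rhd (x y : ℕ × C10) : Prop :=
  if x.2.primary ∨ y.2.primary then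
    y.1 + 1 + (if x.2.idx < y.2.idx then 1 else 0) ≤ x.1
  else
    y.1 + 1 + (if x.2.idx ≤ y.2.idx then 1 else 0) ≤ x.1

/-- An Alladi–Andrews–Berkovich quaternary partition, encoded as the list `l` of its primary
and secondary parts in decreasing lexicographic order together with the decreasing list `Q` of
sizes of its parts of quaternary color `abcd`: secondary parts have size at least 2,
consecutive primary/secondary parts satisfy `▷`, quaternary parts pairwise differ by at
least 4, and every quaternary part is at least `4 + 2τ − χ(1_a is a part)` where `τ` is the
number of primary and secondary parts. -/
def IsAAB (l : List (ℕ × C10)) (Q : List ℕ) : Prop :=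
  (∀ x ∈ l, InPS x) ∧ l.Chain' Rhd ∧ Q.Chain' (fun x y => y + 4 ≤ x) ∧
    ∀ K ∈ Q, 4 + 2 * l.length - (if (1, C10.a) ∈ l then 1 else 0) ≤ K

namespace C10

/-- Twice the gap contribution of a color against a quaternary part: `0` for colors up to `ad`,
`2` for `c` and `d`, and `1` in between. -/
def level : C10 → ℕ
  | .ab => 0
  | .ac => 0
  | .ad => 0
  | .c => 2
  | .d => 2
  | _ => 1

end C10

/-- Items of a mixed sequence: primary or secondary parts (`inl`) and quaternary parts, given by
their size (`inr`). -/
abbrev MixedItem := (ℕ × C10) ⊕ ℕ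

namespace MixedItem

/-- The least size of a quaternary part that may stand directly before a given part. -/
def threshold (y : ℕ × C10) : ℕ :=
  2 * y.1 + 3 + y.2.level - (if y = (1, C10.a) then 1 else 0)

/-- The larger half of a quaternary part. -/
def hi (K : ℕ) : ℕ × C10 :=
  if K % 2 = 0 then (K / 2, C10.cd) else (K / 2 + 1, C10.ad)

/-- The smaller half of a quaternary part. -/
def lo (K : ℕ) : ℕ × C10 :=
  if K % 2 = 0 then (K / 2, C10.ab) else (K / 2, C10.bc)

/-- Admissible sizes of items. -/
def Ok : MixedItem → Prop
  | .inl x => InPS x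
  | .inr K => 4 ≤ K

/-- The relation between adjacent items of a mixed sequence. -/
def Before : MixedItem → MixedItem → Prop
  | .inl x, .inl y => Rhd x y
  | .inl x, .inr K => K + 4 ≤ 2 * x.1 + x.2.level
  | .inr K, .inl y => threshold y ≤ K
  | .inr K, .inr L => L + 4 ≤ K

/-- Valid mixed sequences. -/
def Valid : List MixedItem → Prop
  | [] => True
  | i :: M => Ok i ∧ (∀ j ∈ M.head?, Before i j) ∧ Valid M

/-- Split every quaternary part into its two halves. -/
def flat : List MixedItem → List (ℕ × C10)
  | [] => []
  | .inl x :: M => x :: flat M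
  | .inr K :: M => hi K :: lo K :: flat M

/-- Move all quaternary parts to the front: each exchange lowers the primary or secondary part
by two and raises the quaternary part by two. -/
def unmix : List MixedItem → List (ℕ × C10) × List ℕ
  | [] => ([], [])
  | .inl x :: M =>
      ((x.1 - 2 * (unmix M).2.length, x.2) :: (unmix M).1, (unmix M).2.map (· + 2))
  | .inr K :: M => ((unmix M).1, K :: (unmix M).2)

/-- The effect of `Before` on the head of `unmix`. -/
def Fits : MixedItem → List (ℕ × C10) → List ℕ → Prop
  | .inl x, l, Q => (∀ K ∈ Q.head?, K + 4 ≤ 2 * x.1 + x.2.level) ∧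
      ∀ y ∈ l.head?, Rhd (x.1 - 2 * Q.length, x.2) y
  | .inr K, l, Q => (∀ L ∈ Q.head?, L + 4 ≤ K) ∧
      ∀ y ∈ l.head?, threshold y + 4 * Q.length ≤ K

/-! ### Splitting quaternary parts -/

theorem before_inl_inr_iff (x : ℕ × C10) (K : ℕ) :
    Before (.inl x) (.inr K) ↔ Rhd x (hi K) := by
  obtain ⟨m, p⟩ := x
  rcases Nat.even_or_odd' K with ⟨k, rfl | rfl⟩ <;> cases p <;>
    simp [Before, Rhd, hi, C10.level, C10.primary, C10.idx, Nat.add_mod] <;> omega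

theorem before_inr_inr_iff (K L : ℕ) :
    Before (.inr K) (.inr L) ↔ Rhd (lo K) (hi L) := by
  rcases Nat.even_or_odd' K with ⟨k, rfl | rfl⟩ <;>
    rcases Nat.even_or_odd' L with ⟨l, rfl | rfl⟩ <;>
    simp [Before, Rhd, hi, lo, C10.primary, C10.idx, Nat.add_mod] <;> omega

theorem before_inr_inl_iff {K : ℕ} {y : ℕ × C10} (hK : 4 ≤ K) (hy : InPS y) :
    Before (.inr K) (.inl y) ↔ Rhd (lo K) y ∧ ¬ Forbidden (hi K) (lo K) y := by
  obtain ⟨m, p⟩ := y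
  have := hy.1
  rcases Nat.even_or_odd' K with ⟨k, rfl | rfl⟩ <;> cases p <;>
    simp [Before, threshold, Forbidden, Rhd, hi, lo, C10.level, C10.primary, C10.idx,
      Nat.add_mod] at * <;> (try split_ifs) <;> omega

theorem not_rhd_hi_lo (K : ℕ) : ¬ Rhd (hi K) (lo K) := by
  rcases Nat.even_or_odd' K with ⟨k, rfl | rfl⟩ <;>
    simp [Rhd, hi, lo, C10.primary, C10.idx, Nat.add_mod]

theorem gg_iff (x y : ℕ × C10) : GG x y ↔ Rhd x y ∨ ∃ K, x = hi K ∧ y = lo K := by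
  obtain ⟨m, p⟩ := x
  obtain ⟨n, q⟩ := y
  constructor
  · intro h
    by_cases h1 : p = C10.cd ∧ q = C10.ab ∧ m = n
    · obtain ⟨rfl, rfl, rfl⟩ := h1
      exact Or.inr ⟨2 * m, by simp [hi, lo]⟩
    by_cases h2 : p = C10.ad ∧ q = C10.bc ∧ m = n + 1
    · obtain ⟨rfl, rfl, rfl⟩ := h2
      refine Or.inr ⟨2 * n + 1, ?_⟩
      simp [hi, lo, Nat.add_mod]
      omega
    left
    cases p <;> cases q <;>
      simp [GG, Succ, Rhd, C10.primary, C10.idx] at * <;> omega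
  · rintro (h | ⟨K, h1, h2⟩)
    · cases p <;> cases q <;>
        simp [GG, Succ, Rhd, C10.primary, C10.idx] at * <;> omega
    · rw [h1, h2]
      rcases Nat.even_or_odd' K with ⟨k, rfl | rfl⟩ <;>
        simp [GG, Succ, hi, lo, C10.idx, Nat.add_mod]

theorem gg_lo {K : ℕ} {y : ℕ × C10} (h : GG (lo K) y) : Rhd (lo K) y := by
  rcases (gg_iff _ _).1 h with h | ⟨L, h1, -⟩
  · exact h
  · unfold lo hi at h1
    split_ifs at h1 <;> simp at h1

theorem hi_ne_lo (K L : ℕ) : hi K ≠ lo L := by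
  unfold lo hi
  split_ifs <;> simp

theorem not_forbidden_of_rhd {x y : ℕ × C10} (z : ℕ × C10) (h : Rhd x y) :
    ¬ Forbidden x y z := by
  obtain ⟨m, p⟩ := x
  obtain ⟨n, q⟩ := y
  rintro ⟨-, ⟨h1, h2, h3, -⟩ | ⟨h1, h2, h3, -⟩⟩ <;> simp only at h1 h2 h3 <;> subst h1 h2 h3 <;>
    simp [Rhd, C10.primary, C10.idx] at h

theorem hi_add_lo (K : ℕ) : (hi K).1 + (lo K).1 = K := by
  unfold hi lo
  split_ifs <;> simp <;> omega

theorem hi_injective : Function.Injective hi := by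
  intro K L h
  unfold hi at h
  split_ifs at h <;> simp at h <;> omega

theorem inPS_hi {K : ℕ} (h : 4 ≤ K) : InPS (hi K) := by
  unfold hi
  split_ifs <;> refine ⟨?_, fun _ => ?_⟩ <;> simp <;> omega

theorem inPS_lo {K : ℕ} (h : 4 ≤ K) : InPS (lo K) := by
  unfold lo
  split_ifs <;> refine ⟨?_, fun _ => ?_⟩ <;> simp <;> omega

theorem four_le_of_inPS_lo {K : ℕ} (h : InPS (lo K)) : 4 ≤ K := by
  unfold lo at h
  split_ifs at h <;> have := h.2 rfl <;> simp at this <;> omega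

theorem inE1_nil : InE1 [] := by
  refine ⟨by simp, List.isChain_nil, fun x y z h => ?_⟩
  simp at h

theorem inE1_cons (x : ℕ × C10) (l : List (ℕ × C10)) :
    InE1 (x :: l) ↔ InPS x ∧ (∀ y ∈ l.head?, GG x y) ∧
      (∀ y z, [y, z] <+: l → ¬ Forbidden x y z) ∧ InE1 l := by
  unfold InE1 List.Chain'
  rw [List.isChain_cons]
  simp only [List.mem_cons, forall_eq_or_imp, List.infix_cons_iff, List.cons_prefix_cons]
  constructor
  · rintro ⟨⟨h1, h2⟩, ⟨h3, h4⟩, h5⟩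
    exact ⟨h1, h3, fun y z h => h5 x y z (Or.inl ⟨rfl, h⟩), h2, h4,
      fun a y z h => h5 a y z (Or.inr h)⟩
  · rintro ⟨h1, h3, h5, h2, h4, h6⟩
    refine ⟨⟨h1, h2⟩, ⟨h3, h4⟩, ?_⟩
    rintro a y z (⟨rfl, h⟩ | h)
    · exact h5 y z h
    · exact h6 a y z h

theorem inE1_flat : ∀ M : List MixedItem, Valid M → InE1 (flat M)
  | [], _ => inE1_nil
  | [.inl x], h => by
      simp only [flat, inE1_cons]
      exact ⟨h.1, by simp, by simp, inE1_nil⟩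
  | [.inr K], h => by
      simp only [flat, inE1_cons]
      refine ⟨inPS_hi h.1, ?_, by simp, inPS_lo h.1, by simp, by simp, inE1_nil⟩
      simpa using (gg_iff _ _).2 (Or.inr ⟨K, rfl, rfl⟩)
  | .inl x :: .inl y :: M, h => by
      have ih := inE1_flat _ h.2.2
      have hb : Rhd x y := h.2.1 _ rfl
      simp only [flat] at ih ⊢
      rw [inE1_cons]
      refine ⟨h.1, by simpa using (gg_iff _ _).2 (Or.inl hb), ?_, ih⟩
      rintro y' z hz
      obtain ⟨rfl, -⟩ := List.cons_prefix_cons.1 hz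
      exact not_forbidden_of_rhd z hb
  | .inl x :: .inr K :: M, h => by
      have ih := inE1_flat _ h.2.2
      have hb : Rhd x (hi K) := (before_inl_inr_iff _ _).1 (h.2.1 _ rfl)
      simp only [flat] at ih ⊢
      rw [inE1_cons]
      refine ⟨h.1, by simpa using (gg_iff _ _).2 (Or.inl hb), ?_, ih⟩
      rintro y' z hz
      obtain ⟨rfl, -⟩ := List.cons_prefix_cons.1 hz
      exact not_forbidden_of_rhd z hb
  | .inr K :: .inl y :: M, h => by
      have ih := inE1_flat _ h.2.2
      have hb := (before_inr_inl_iff h.1 h.2.2.1).1 (h.2.1 _ rfl)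
      simp only [flat] at ih ⊢
      rw [inE1_cons, inE1_cons (lo K)]
      refine ⟨inPS_hi h.1, ?_, ?_, inPS_lo h.1,
        by simpa using (gg_iff _ _).2 (Or.inl hb.1), ?_, ih⟩
      · simpa using (gg_iff _ _).2 (Or.inr ⟨K, rfl, rfl⟩)
      · intro y' z hz
        simp only [List.cons_prefix_cons] at hz
        obtain ⟨rfl, rfl, -⟩ := hz
        exact hb.2
      · intro y' z hz
        obtain ⟨rfl, -⟩ := List.cons_prefix_cons.1 hz
        exact not_forbidden_of_rhd z hb.1
  | .inr K :: .inr L :: M, h => by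
      have ih := inE1_flat _ h.2.2
      have hb := (before_inr_inr_iff K L).1 (h.2.1 _ rfl)
      simp only [flat] at ih ⊢
      rw [inE1_cons, inE1_cons (lo K)]
      refine ⟨inPS_hi h.1, ?_, ?_, inPS_lo h.1,
        by simpa using (gg_iff _ _).2 (Or.inl hb), ?_, ih⟩
      · simpa using (gg_iff _ _).2 (Or.inr ⟨K, rfl, rfl⟩)
      · intro y' z hz
        simp only [List.cons_prefix_cons] at hz
        obtain ⟨rfl, rfl, -⟩ := hz
        rintro ⟨-, ⟨-, -, -, -, h1⟩ | ⟨-, -, -, -, h1⟩⟩ <;> unfold hi at h1 <;>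
          split_ifs at h1 <;> simp at h1
      · intro y' z hz
        obtain ⟨rfl, -⟩ := List.cons_prefix_cons.1 hz
        exact not_forbidden_of_rhd z hb

theorem exists_flat_eq : ∀ l : List (ℕ × C10), InE1 l → ∃ M, Valid M ∧ flat M = l
  | [], _ => ⟨[], trivial, rfl⟩
  | [x], h => ⟨[.inl x], ⟨((inE1_cons _ _).1 h).1, by simp, trivial⟩, rfl⟩
  | x :: y :: l, h => by
      obtain ⟨hx, hxy, hf, h'⟩ := (inE1_cons _ _).1 h
      obtain ⟨hy, hyl, -, hl⟩ := (inE1_cons _ _).1 h'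
      rcases (gg_iff _ _).1 (hxy y rfl) with hr | ⟨K, rfl, rfl⟩
      · obtain ⟨M, hM, he⟩ := exists_flat_eq (y :: l) h'
        refine ⟨.inl x :: M, ⟨hx, ?_, hM⟩, by simp [flat, he]⟩
        rcases M with _ | ⟨z | L, M⟩
        · simp
        · obtain ⟨rfl, -⟩ := List.cons.inj he
          simpa [Before] using hr
        · obtain ⟨rfl, -⟩ := List.cons.inj he
          simpa using (before_inl_inr_iff _ _).2 hr
      · obtain ⟨M, hM, rfl⟩ := exists_flat_eq l hl
        have hK := four_le_of_inPS_lo hy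
        refine ⟨.inr K :: M, ⟨hK, ?_, hM⟩, rfl⟩
        rcases M with _ | ⟨z | L, M⟩
        · simp
        · have h1 : Before (.inr K) (.inl z) :=
            (before_inr_inl_iff hK hM.1).2 ⟨gg_lo (hyl _ rfl), hf _ z (by simp [flat])⟩
          simpa using h1
        · simpa using (before_inr_inr_iff K L).2 (gg_lo (hyl _ rfl))

theorem flat_inl_ne_flat_inr {x : ℕ × C10} {K : ℕ} {M N : List MixedItem}
    (hM : Valid (.inl x :: M)) : flat (.inl x :: M) ≠ flat (.inr K :: N) := by
  intro h
  simp only [flat, List.cons.injEq] at h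
  obtain ⟨rfl, h⟩ := h
  rcases M with _ | ⟨z | L, M⟩
  · simp [flat] at h
  · simp only [flat, List.cons.injEq] at h
    obtain ⟨rfl, -⟩ := h
    exact not_rhd_hi_lo K (hM.2.1 _ rfl)
  · exact hi_ne_lo _ _ (List.cons.inj h).1

theorem flat_injOn : ∀ M N : List MixedItem, Valid M → Valid N → flat M = flat N → M = N
  | [], [], _, _, _ => rfl
  | [], .inl _ :: _, _, _, h => by simp [flat] at h
  | [], .inr _ :: _, _, _, h => by simp [flat] at h
  | .inl _ :: _, [], _, _, h => by simp [flat] at h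
  | .inr _ :: _, [], _, _, h => by simp [flat] at h
  | .inl x :: M, .inl y :: N, hM, hN, h => by
      simp only [flat, List.cons.injEq] at h
      obtain ⟨rfl, h⟩ := h
      rw [flat_injOn M N hM.2.2 hN.2.2 h]
  | .inl x :: M, .inr K :: N, hM, _, h => (flat_inl_ne_flat_inr hM h).elim
  | .inr K :: M, .inl x :: N, _, hN, h => (flat_inl_ne_flat_inr hN h.symm).elim
  | .inr K :: M, .inr L :: N, hM, hN, h => by
      obtain ⟨h1, h⟩ := List.cons.inj h
      rw [hi_injective h1, flat_injOn M N hM.2.2 hN.2.2 (List.cons.inj h).2]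

/-! ### Moving quaternary parts to the front -/

theorem one_le_level {y : ℕ × C10} (h : InPS y) (hy : y.1 ≤ 1) : 1 ≤ y.2.level := by
  obtain ⟨m, p⟩ := y
  obtain ⟨h1, h2⟩ := h
  cases p <;> simp [C10.level, C10.primary] at * <;> omega

theorem level_le (p : C10) : p.level ≤ 2 := by
  cases p <;> simp [C10.level]

theorem rhd_level {x y : ℕ × C10} (h : Rhd x y) :
    y.1 + 1 ≤ x.1 ∧ 2 * y.1 + 2 + y.2.level ≤ 2 * x.1 + x.2.level := by
  obtain ⟨m, p⟩ := x
  obtain ⟨n, q⟩ := y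
  cases p <;> cases q <;> simp [Rhd, C10.level, C10.primary, C10.idx] at * <;> omega

theorem threshold_lower {l : List (ℕ × C10)} {y : ℕ × C10} (hl : ∀ x ∈ y :: l, InPS x)
    (hc : (y :: l).IsChain Rhd) :
    6 + 2 * l.length ≤ 2 * y.1 + 3 + y.2.level := by
  induction l generalizing y with
  | nil =>
    have h := hl y (by simp)
    have := h.1
    by_cases hy : y.1 ≤ 1
    · have := one_le_level h hy
      simp; omega
    · simp; omega
  | cons z l ih =>
    rw [List.isChain_cons_cons] at hc
    have := ih (fun x hx => hl x (List.mem_cons_of_mem _ hx)) hc.2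
    have := rhd_level hc.1
    simp only [List.length_cons]
    omega

theorem isAAB_bound {l : List (ℕ × C10)} {Q : List ℕ} {K : ℕ} (h : IsAAB l (K :: Q)) :
    4 + 2 * l.length - (if (1, C10.a) ∈ l then 1 else 0) + 4 * Q.length ≤ K := by
  obtain ⟨-, -, h3, h4⟩ := h
  induction Q generalizing K with
  | nil => simpa using h4 K (by simp)
  | cons L Q ih =>
    unfold List.Chain' at h3 ih
    rw [List.isChain_cons_cons] at h3
    have := ih h3.2 (fun x hx => h4 x (List.mem_cons_of_mem _ hx))
    simp only [List.length_cons]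
    omega

theorem isAAB_cons_inr {l : List (ℕ × C10)} {Q : List ℕ} {K : ℕ} :
    IsAAB l (K :: Q) ↔ IsAAB l Q ∧ (∀ L ∈ Q.head?, L + 4 ≤ K) ∧
      4 + 2 * l.length - (if (1, C10.a) ∈ l then 1 else 0) ≤ K := by
  unfold IsAAB List.Chain'
  rw [List.isChain_cons (l := Q)]
  simp only [List.mem_cons, forall_eq_or_imp]
  tauto

theorem isAAB_cons_inl {l : List (ℕ × C10)} {Q : List ℕ} {y : ℕ × C10}
    (hy : Q ≠ [] → y ≠ (1, C10.a)) :
    IsAAB (y :: l) (Q.map (· + 2)) ↔ InPS y ∧ (∀ z ∈ l.head?, Rhd y z) ∧ IsAAB l Q := by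
  unfold IsAAB List.Chain'
  rw [List.isChain_cons (l := l), List.isChain_map]
  have h1 : (Q.IsChain fun a b => b + 2 + 4 ≤ a + 2) ↔ Q.IsChain fun a b => b + 4 ≤ a := by
    have : (fun a b : ℕ => b + 2 + 4 ≤ a + 2) = fun a b => b + 4 ≤ a := by
      ext a b; omega
    rw [this]
  have h2 : (∀ K ∈ Q.map (· + 2),
      4 + 2 * (y :: l).length - (if (1, C10.a) ∈ y :: l then 1 else 0) ≤ K) ↔
      ∀ K ∈ Q, 4 + 2 * l.length - (if (1, C10.a) ∈ l then 1 else 0) ≤ K := by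
    simp only [List.forall_mem_map]
    refine forall₂_congr fun K hK => ?_
    have hne := hy (List.ne_nil_of_mem hK)
    have : (1, C10.a) ∈ y :: l ↔ (1, C10.a) ∈ l := by
      simp [hne.symm]
    simp only [this, List.length_cons]
    split_ifs <;> omega
  rw [h1, h2]
  simp only [List.mem_cons, forall_eq_or_imp]
  tauto

theorem isAAB_four_mul_le {l : List (ℕ × C10)} {Q : List ℕ} {K : ℕ} (h : IsAAB l (K :: Q)) :
    4 + 4 * Q.length ≤ K := by
  have := isAAB_bound h
  rcases l with _ | ⟨y, l⟩
  · simpa using this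
  · simp only [List.length_cons] at this
    split_ifs at this <;> omega

/-- A part that can precede the quaternary parts `Q` remains admissible after passing them. -/
theorem lowered_part {l : List (ℕ × C10)} {Q : List ℕ} {x : ℕ × C10} (h : IsAAB l Q)
    (hx : InPS x) (hK : ∀ K ∈ Q.head?, K + 4 ≤ 2 * x.1 + x.2.level) :
    2 * Q.length ≤ x.1 ∧ InPS (x.1 - 2 * Q.length, x.2) ∧
      (Q ≠ [] → (x.1 - 2 * Q.length, x.2) ≠ (1, C10.a)) := by
  rcases Q with _ | ⟨K, Q⟩
  · simpa using hx
  have h1 := isAAB_four_mul_le h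
  have h2 := hK K rfl
  obtain ⟨m, p⟩ := x
  simp only [List.length_cons] at *
  have := level_le p
  refine ⟨by omega, ⟨by simp only; omega, fun hp => ?_⟩, fun _ he => ?_⟩
  · have : p.level ≤ 1 := by cases p <;> simp [C10.level, C10.primary] at *
    simp only
    omega
  · simp only [Prod.mk.injEq] at he
    obtain ⟨he, rfl⟩ := he
    simp only [C10.level] at h2
    omega

theorem threshold_of_ne {y : ℕ × C10} (h : y ≠ (1, C10.a)) :
    threshold y = 2 * y.1 + 3 + y.2.level := by
  simp [threshold, h]

theorem threshold_lowered {Q : List ℕ} {x : ℕ × C10} (h1 : 2 * Q.length ≤ x.1)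
    (h2 : Q ≠ [] → (x.1 - 2 * Q.length, x.2) ≠ (1, C10.a)) :
    threshold (x.1 - 2 * Q.length, x.2) + 4 * Q.length = threshold x := by
  rcases Q with _ | ⟨K, Q⟩
  · simp
  have h3 := h2 (by simp)
  have h4 : x ≠ (1, C10.a) := by
    rintro rfl
    simp at h1
    omega
  rw [threshold_of_ne h3, threshold_of_ne h4]
  simp only
  omega

theorem rhd_sub_iff {x y : ℕ × C10} {n : ℕ} (h : n ≤ y.1) :
    Rhd (x.1 - n, x.2) (y.1 - n, y.2) ↔ Rhd x y := by
  unfold Rhd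
  split_ifs <;> simp only <;> omega

theorem rhd_of_levels {x y : ℕ × C10} (h : threshold y ≤ 2 * x.1 + x.2.level) : Rhd x y := by
  obtain ⟨m, p⟩ := x
  obtain ⟨n, q⟩ := y
  unfold threshold at h
  cases p <;> cases q <;> simp [Rhd, C10.level, C10.primary, C10.idx] at * <;>
    (try split_ifs at h) <;> omega

theorem isAAB_unmix (M : List MixedItem) (hM : Valid M) :
    IsAAB (unmix M).1 (unmix M).2 ∧
      ∀ i, Ok i → ((∀ j ∈ M.head?, Before i j) ↔ Fits i (unmix M).1 (unmix M).2) := by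
  induction M with
  | nil =>
    refine ⟨⟨by simp [unmix], List.isChain_nil, List.isChain_nil, by simp [unmix]⟩, ?_⟩
    rintro (x | K) - <;> simp [Fits, unmix]
  | cons j M ih =>
    obtain ⟨hj, hjM, hM⟩ := hM
    obtain ⟨ih1, ih2⟩ := ih hM
    have hF := (ih2 j hj).1 hjM
    clear ih2 hjM ih
    generalize hu : unmix M = u at ih1 hF
    obtain ⟨l, Q⟩ := u
    rcases j with z | L
    · obtain ⟨h1, h2, h3⟩ := lowered_part ih1 hj hF.1
      have ht := threshold_lowered h1 h3
      simp only [unmix, hu]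
      refine ⟨(isAAB_cons_inl h3).2 ⟨h2, hF.2, ih1⟩, ?_⟩
      rintro (x | K) -
      · simp only [Fits, Before, List.head?_cons, Option.mem_def, Option.some.injEq,
          forall_eq', List.length_map]
        rw [rhd_sub_iff h1, iff_and_self]
        intro hr
        have := rhd_level hr
        rcases Q with _ | ⟨L, Q⟩
        · simp
        · have := hF.1 L rfl
          simp
          omega
      · simp only [Fits, Before, List.head?_cons, Option.mem_def, Option.some.injEq,
          forall_eq', List.length_map]
        rw [ht, iff_and_self]
        intro hr
        rcases Q with _ | ⟨L, Q⟩
        · simp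
        · have := hF.1 L rfl
          unfold threshold at hr
          simp
          split_ifs at hr <;> omega
    · simp only [unmix, hu]
      refine ⟨isAAB_cons_inr.2 ⟨ih1, hF.1, ?_⟩, ?_⟩
      · rcases l with _ | ⟨y, l⟩
        · simpa [Ok] using hj
        · have h1 := hF.2 y rfl
          have h2 := threshold_lower ih1.1 ih1.2.1
          by_cases hy : y = (1, C10.a)
          · subst hy
            simp only [threshold, C10.level, if_true] at h1 h2
            simp only [List.length_cons, List.mem_cons, true_or, if_true]
            omega
          · rw [threshold_of_ne hy] at h1
            simp only [List.length_cons]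
            omega
      · rintro (x | K) -
        · simp only [Fits, Before, List.head?_cons, Option.mem_def, Option.some.injEq,
            forall_eq', List.length_cons]
          rw [iff_self_and]
          intro hL y hy
          have := hF.2 y hy
          simp only at this
          apply rhd_of_levels
          simp only
          omega
        · simp only [Fits, Before, List.head?_cons, Option.mem_def, Option.some.injEq,
            forall_eq', List.length_cons]
          rw [iff_self_and]
          intro hL y hy
          have := hF.2 y hy
          simp only at this
          omega

theorem exists_map_add_two {Q : List ℕ} (h : ∀ K ∈ Q, 2 ≤ K) : ∃ P : List ℕ, Q = P.map (· + 2) := by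
  refine ⟨Q.map (· - 2), ?_⟩
  rw [List.map_map]
  conv_lhs => rw [← List.map_id Q]
  refine List.map_congr_left fun K hK => ?_
  have := h K hK
  simp
  omega

theorem four_le_of_mem {l : List (ℕ × C10)} {Q : List ℕ} (h : IsAAB l Q) {K : ℕ}
    (hK : K ∈ Q) : 4 ≤ K := by
  have := h.2.2.2 K hK
  rcases l with _ | ⟨y, l⟩
  · simpa using this
  · simp only [List.length_cons] at this
    split_ifs at this <;> omega

theorem exists_unmix_eq (n : ℕ) : ∀ (l : List (ℕ × C10)) (Q : List ℕ),
    l.length + Q.length = n → IsAAB l Q → ∃ M, Valid M ∧ unmix M = (l, Q) := by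
  induction n with
  | zero =>
    intro l Q hn _
    obtain rfl : l = [] := List.length_eq_zero_iff.1 (by omega)
    obtain rfl : Q = [] := List.length_eq_zero_iff.1 (by omega)
    exact ⟨[], trivial, rfl⟩
  | succ n ih =>
    intro l Q hn h
    by_cases hq : ∃ K P, Q = K :: P ∧ ∀ y ∈ l.head?, threshold y + 4 * P.length ≤ K
    · obtain ⟨K, P, rfl, hK⟩ := hq
      obtain ⟨h1, h2, -⟩ := isAAB_cons_inr.1 h
      obtain ⟨M, hM, he⟩ := ih l P (by simp at hn; omega) h1
      have hk : Ok (.inr K) := four_le_of_mem h (by simp)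
      refine ⟨.inr K :: M, ⟨hk, ?_, hM⟩, by simp [unmix, he]⟩
      rw [(isAAB_unmix M hM).2 _ hk, he]
      exact ⟨h2, hK⟩
    · rcases l with _ | ⟨y, l⟩
      · rcases Q with _ | ⟨K, P⟩
        · simp at hn
        · exact absurd ⟨K, P, rfl, by simp⟩ hq
      obtain ⟨P, rfl⟩ := exists_map_add_two (Q := Q) fun K hK => by
        have := four_le_of_mem h hK
        omega
      have hlt : ∀ K ∈ P.head?, K + 2 < threshold y + 4 * (P.length - 1) := by
        rcases P with _ | ⟨K, P⟩
        · simp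
        · by_contra! hc
          refine hq ⟨K + 2, P.map (· + 2), rfl, ?_⟩
          simpa using hc
      have hne : P ≠ [] → y ≠ (1, C10.a) := by
        rintro hP rfl
        rcases P with _ | ⟨K, P⟩
        · exact hP rfl
        · have h1 := isAAB_bound h
          have h2 := hlt K rfl
          simp [threshold, C10.level] at h1 h2
          omega
      obtain ⟨h1, h2, h3⟩ := (isAAB_cons_inl hne).1 h
      obtain ⟨M, hM, he⟩ := ih l P (by simp at hn; omega) h3
      have hk : Ok (.inl (y.1 + 2 * P.length, y.2)) :=
        ⟨by have := h1.1; simp only; omega, fun hp => by have := h1.2 hp; simp only; omega⟩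
      refine ⟨.inl (y.1 + 2 * P.length, y.2) :: M, ⟨hk, ?_, hM⟩, by simp [unmix, he]⟩
      rw [(isAAB_unmix M hM).2 _ hk, he]
      refine ⟨?_, by simpa using h2⟩
      rcases P with _ | ⟨K, P⟩
      · simp
      · have := hlt K rfl
        rw [threshold_of_ne (hne (by simp))] at this
        simp at this ⊢
        omega

theorem fits_of_valid {i : MixedItem} {M : List MixedItem} (h : Valid (i :: M)) :
    Ok i ∧ IsAAB (unmix M).1 (unmix M).2 ∧ Fits i (unmix M).1 (unmix M).2 :=
  have h1 := isAAB_unmix M h.2.2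
  ⟨h.1, h1.1, (h1.2 i h.1).1 h.2.1⟩

theorem two_mul_length_le {x : ℕ × C10} {M : List MixedItem} (h : Valid (.inl x :: M)) :
    2 * (unmix M).2.length ≤ x.1 :=
  have ⟨h1, h2, h3⟩ := fits_of_valid h
  (lowered_part h2 h1 h3.1).1

theorem unmix_inl_ne_unmix_inr {x : ℕ × C10} {K : ℕ} {M N : List MixedItem}
    (hM : Valid (.inl x :: M)) (hN : Valid (.inr K :: N)) :
    unmix (.inl x :: M) ≠ unmix (.inr K :: N) := by
  obtain ⟨m1, m2, m3⟩ := fits_of_valid hM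
  obtain ⟨-, -, n3⟩ := fits_of_valid hN
  obtain ⟨h1, -, h3⟩ := lowered_part m2 m1 m3.1
  simp only [unmix]
  generalize unmix M = u at *
  generalize unmix N = v at *
  obtain ⟨l, Q⟩ := u
  obtain ⟨l', Q'⟩ := v
  intro h
  simp only [Prod.mk.injEq] at h
  obtain ⟨rfl, h⟩ := h
  rcases Q with _ | ⟨L, Q⟩
  · simp at h
  simp only [List.map_cons, List.cons.injEq] at h
  obtain ⟨rfl, rfl⟩ := h
  have h4 := m3.1 L rfl
  have h5 := n3.2 _ rfl
  rw [threshold_of_ne (h3 (by simp))] at h5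
  simp at h1 h5
  omega

theorem unmix_injOn : ∀ M N : List MixedItem, Valid M → Valid N → unmix M = unmix N → M = N
  | [], [], _, _, _ => rfl
  | [], .inl _ :: _, _, _, h => by simp [unmix] at h
  | [], .inr _ :: _, _, _, h => by simp [unmix] at h
  | .inl _ :: _, [], _, _, h => by simp [unmix] at h
  | .inr _ :: _, [], _, _, h => by simp [unmix] at h
  | .inl x :: M, .inl y :: N, hM, hN, h => by
      have h1 := two_mul_length_le hM
      have h2 := two_mul_length_le hN
      simp only [unmix, Prod.mk.injEq, List.cons.injEq] at h
      obtain ⟨⟨⟨h3, h4⟩, h5⟩, h6⟩ := h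
      have h7 := List.map_injective_iff.2 (add_left_injective 2) h6
      obtain rfl := unmix_injOn M N hM.2.2 hN.2.2 (Prod.ext h5 h7)
      have : x = y := Prod.ext (by omega) h4
      rw [this]
  | .inl x :: M, .inr K :: N, hM, hN, h => (unmix_inl_ne_unmix_inr hM hN h).elim
  | .inr K :: M, .inl x :: N, hM, hN, h => (unmix_inl_ne_unmix_inr hN hM h.symm).elim
  | .inr K :: M, .inr L :: N, hM, hN, h => by
      simp only [unmix, Prod.mk.injEq, List.cons.injEq] at h
      obtain ⟨h1, rfl, h2⟩ := h
      rw [unmix_injOn M N hM.2.2 hN.2.2 (Prod.ext h1 h2)]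

/-! ### Conserved quantities -/

theorem sum_unmix : ∀ M : List MixedItem, Valid M →
    ((unmix M).1.map Prod.fst).sum + (unmix M).2.sum = ((flat M).map Prod.fst).sum
  | [], _ => rfl
  | .inl x :: M, h => by
      have h1 := two_mul_length_le h
      have h2 := sum_unmix M h.2.2
      simp [unmix, flat] at *
      omega
  | .inr K :: M, h => by
      have h1 := hi_add_lo K
      have h2 := sum_unmix M h.2.2
      simp [unmix, flat] at *
      omega

theorem countP_unmix (f : C10 → Bool)
    (hf : ∀ K, (if f (hi K).2 then 1 else 0) + (if f (lo K).2 then 1 else 0) = 1)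
    (M : List MixedItem) :
    (unmix M).1.countP (fun x => f x.2) + (unmix M).2.length =
      (flat M).countP (fun x => f x.2) := by
  induction M with
  | nil => rfl
  | cons i M ih =>
    rcases i with x | K
    · simp only [unmix, flat, List.countP_cons, List.length_map]
      omega
    · have := hf K
      simp only [unmix, flat, List.countP_cons, List.length_cons]
      omega

/-- Valid mixed sequences whose flattening has the given property are in bijection with the
members of `E₁` that have it. -/
theorem card_flat (P : List (ℕ × C10) → Prop) :
    Nat.card {M // Valid M ∧ P (flat M)} = Nat.card {l // InE1 l ∧ P l} := by
  refine Nat.card_congr (Equiv.ofBijective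
    (fun M => ⟨flat M.1, inE1_flat _ M.2.1, M.2.2⟩) ⟨?_, ?_⟩)
  · intro M N h
    exact Subtype.ext (flat_injOn _ _ M.2.1 N.2.1 (congrArg Subtype.val h))
  · rintro ⟨l, hl, hP⟩
    obtain ⟨M, hM, rfl⟩ := exists_flat_eq l hl
    exact ⟨⟨M, hM, hP⟩, rfl⟩

/-- Valid mixed sequences are in bijection with quaternary partitions. -/
theorem card_unmix (P : List (ℕ × C10) × List ℕ → Prop) :
    Nat.card {M // Valid M ∧ P (unmix M)} = Nat.card {p // IsAAB p.1 p.2 ∧ P p} := by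
  refine Nat.card_congr (Equiv.ofBijective
    (fun M => ⟨unmix M.1, (isAAB_unmix _ M.2.1).1, M.2.2⟩) ⟨?_, ?_⟩)
  · intro M N h
    exact Subtype.ext (unmix_injOn _ _ M.2.1 N.2.1 (congrArg Subtype.val h))
  · rintro ⟨⟨l, Q⟩, hl, hP⟩
    obtain ⟨M, hM, he⟩ := exists_unmix_eq _ l Q rfl hl
    exact ⟨⟨M, hM, he ▸ hP⟩, Subtype.ext he⟩

end MixedItem

/-- The bijection of Section 5: for all `u, v, w, t, n`, the number of partitions in `E₁`
of `n` with exactly `u`, `v`, `w`, `t` parts whose color contains `a`, `b`, `c`, `d`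
respectively equals the number of AAB quaternary partitions of `n` with the same color
counts (a part of color `abcd` contributing to all four counts). -/
theorem E1_equinumerous_quaternary (u v w t n : ℕ) :
    Nat.card {l : List (ℕ × C10) // InE1 l ∧ (l.map Prod.fst).sum = n ∧
      l.countP (fun x => x.2.hasA) = u ∧ l.countP (fun x => x.2.hasB) = v ∧
      l.countP (fun x => x.2.hasC) = w ∧ l.countP (fun x => x.2.hasD) = t} =
    Nat.card {p : List (ℕ × C10) × List ℕ // IsAAB p.1 p.2 ∧
      (p.1.map Prod.fst).sum + p.2.sum = n ∧
      p.1.countP (fun x => x.2.hasA) + p.2.length = u ∧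
      p.1.countP (fun x => x.2.hasB) + p.2.length = v ∧
      p.1.countP (fun x => x.2.hasC) + p.2.length = w ∧
      p.1.countP (fun x => x.2.hasD) + p.2.length = t} := by
  rw [← MixedItem.card_flat fun l => (l.map Prod.fst).sum = n ∧
      l.countP (fun x => x.2.hasA) = u ∧ l.countP (fun x => x.2.hasB) = v ∧
      l.countP (fun x => x.2.hasC) = w ∧ l.countP (fun x => x.2.hasD) = t,
    ← MixedItem.card_unmix fun p => (p.1.map Prod.fst).sum + p.2.sum = n ∧
      p.1.countP (fun x => x.2.hasA) + p.2.length = u ∧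
      p.1.countP (fun x => x.2.hasB) + p.2.length = v ∧
      p.1.countP (fun x => x.2.hasC) + p.2.length = w ∧
      p.1.countP (fun x => x.2.hasD) + p.2.length = t]
  refine Nat.card_congr (Equiv.subtypeEquivRight fun M => and_congr_right fun hM => ?_)
  rw [MixedItem.sum_unmix M hM, MixedItem.countP_unmix C10.hasA _ M,
    MixedItem.countP_unmix C10.hasB _ M, MixedItem.countP_unmix C10.hasC _ M,
    MixedItem.countP_unmix C10.hasD _ M] <;>
  · intro K
    unfold MixedItem.hi MixedItem.lo
    split_ifs <;> simp_all [C10.hasA, C10.hasB, C10.hasC, C10.hasD]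
end
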